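/- Let f : ℝ → ℝ be a C³ function, bounded together with its first three derivatives, and let u : ℝ×ℝ → ℝ be a smooth classical solution of the mKdV equation u_t + (u_{xx} + u³)_x = 0 such that for each t, u(t,·) together with its x-derivatives up to order three is Schwartz (rapidly decaying). Then for all t, (d/dt)∫ [(1/2)·u_x² − (1/4)·u⁴]·f(x) dx = ∫ [−(1/2)·(u_{xx} + u³)² − u_{xx}² + 3·u²·u_x²]·f'(x) dx + (1/2)∫ u_x²·f'''(x) dx. -/

import Mathlib

open Real MeasureTheory

section LocalizedEnergy

open Filter Topology

/-- `φ₁`, `φ₂`, `φ₃` are the successive derivatives of `φ₀`, and all four functions are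
continuous and bounded by `M`. -/
structure BoundedWeight (φ₀ φ₁ φ₂ φ₃ : ℝ → ℝ) (M : ℝ) : Prop where
  d₀ : ∀ x, HasDerivAt φ₀ (φ₁ x) x
  d₁ : ∀ x, HasDerivAt φ₁ (φ₂ x) x
  d₂ : ∀ x, HasDerivAt φ₂ (φ₃ x) x
  c₀ : Continuous φ₀
  c₁ : Continuous φ₁
  c₂ : Continuous φ₂
  c₃ : Continuous φ₃
  le₀ : ∀ x, |φ₀ x| ≤ M
  le₁ : ∀ x, |φ₁ x| ≤ M
  le₂ : ∀ x, |φ₂ x| ≤ M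
  le₃ : ∀ x, |φ₃ x| ≤ M

/-- A balance law `∂ₜ F = T = ∂ₓ A + S` with a flux of the form `A = a + ∂ₓ B`, `B = b + ∂ₓ C`. -/
structure FluxLaw (F T S A a B b C : ℝ → ℝ → ℝ) : Prop where
  hF : ∀ t x, HasDerivAt (fun s => F s x) (T t x) t
  hA : ∀ t x, HasDerivAt (A t) (T t x - S t x) x
  hB : ∀ t x, HasDerivAt (B t) (A t x - a t x) x
  hC : ∀ t x, HasDerivAt (C t) (B t x - b t x) x
  cF : Continuous (Function.uncurry F)
  cT : Continuous (Function.uncurry T)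
  cS : Continuous (Function.uncurry S)
  ca : Continuous (Function.uncurry a)
  cb : Continuous (Function.uncurry b)
  cC : Continuous (Function.uncurry C)

/-- The flux identity tested against a compactly supported weight. -/
lemma FluxLaw.intervalIntegral_eq {F T S A a B b C : ℝ → ℝ → ℝ} (h : FluxLaw F T S A a B b C)
    {ψ₀ ψ₁ ψ₂ ψ₃ : ℝ → ℝ} {M : ℝ} (w : BoundedWeight ψ₀ ψ₁ ψ₂ ψ₃ M) {R : ℝ}
    (z₀ : ∀ x, R ≤ |x| → ψ₀ x = 0) (z₁ : ∀ x, R ≤ |x| → ψ₁ x = 0)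
    (z₂ : ∀ x, R ≤ |x| → ψ₂ x = 0) (s t : ℝ) :
    (∫ x in (-R)..R, F t x * ψ₀ x) - ∫ x in (-R)..R, F s x * ψ₀ x
      = ∫ τ in s..t, ∫ x in (-R)..R,
          (S τ x * ψ₀ x - a τ x * ψ₁ x + b τ x * ψ₂ x - C τ x * ψ₃ x) := by
  obtain ⟨hF, hA, hB, hC, cF, cT, cS, ca, cb, cC⟩ := h
  obtain ⟨h₀, h₁, h₂, c₀, c₁, c₂, c₃, -, -, -, -⟩ := w
  have step : ∀ τ, ∫ x in (-R)..R, T τ x * ψ₀ x = ∫ x in (-R)..R,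
          (S τ x * ψ₀ x - a τ x * ψ₁ x + b τ x * ψ₂ x - C τ x * ψ₃ x) := by
    intro τ
    have hd : ∀ x ∈ Set.uIcc (-R) R, HasDerivAt
        (fun x => A τ x * ψ₀ x - B τ x * ψ₁ x + C τ x * ψ₂ x)
        (T τ x * ψ₀ x
          - (S τ x * ψ₀ x - a τ x * ψ₁ x + b τ x * ψ₂ x - C τ x * ψ₃ x)) x := by
      intro x _
      have := (((hA τ x).mul (h₀ x)).sub ((hB τ x).mul (h₁ x))).add ((hC τ x).mul (h₂ x))
      refine this.congr_deriv ?_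
      ring
    have hi := intervalIntegral.integral_eq_sub_of_hasDerivAt hd
      (Continuous.intervalIntegrable (by fun_prop) _ _)
    have hR : R ≤ |R| := le_abs_self R
    have hR' : R ≤ |-R| := by rw [abs_neg]; exact hR
    rw [z₀ _ hR, z₁ _ hR, z₂ _ hR, z₀ _ hR', z₁ _ hR', z₂ _ hR',
      intervalIntegral.integral_sub (Continuous.intervalIntegrable (by fun_prop) _ _)
      (Continuous.intervalIntegrable (by fun_prop) _ _)] at hi
    linarith
  rw [← intervalIntegral.integral_sub (Continuous.intervalIntegrable (by fun_prop) _ _)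
      (Continuous.intervalIntegrable (by fun_prop) _ _)]
  simp_rw [← step]
  rw [← intervalIntegral_intervalIntegral_swap (F := fun x τ => T τ x * ψ₀ x)
    ((Continuous.continuousOn (by fun_prop)).integrableOn_compact
      (isCompact_uIcc.prod isCompact_uIcc) |>.mono_set
      (Set.prod_mono Set.uIoc_subset_uIcc Set.uIoc_subset_uIcc))]
  refine intervalIntegral.integral_congr fun x _ => ?_
  rw [intervalIntegral.integral_mul_const,
    intervalIntegral.integral_eq_sub_of_hasDerivAt (fun τ _ => hF τ x)
      (Continuous.intervalIntegrable (by fun_prop) _ _)]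
  ring

/-- A smooth cutoff equal to `1` near the origin and vanishing outside `[-3, 3]`. -/
lemma exists_cutoff : ∃ (χ₀ χ₁ χ₂ χ₃ : ℝ → ℝ) (L : ℝ), BoundedWeight χ₀ χ₁ χ₂ χ₃ L ∧ χ₀ 0 = 1 ∧
    ∀ x, 3 ≤ |x| → χ₀ x = 0 ∧ χ₁ x = 0 ∧ χ₂ x = 0 ∧ χ₃ x = 0 := by
  let χ : ContDiffBump (0 : ℝ) := ⟨1, 2, one_pos, one_lt_two⟩
  have hc : ContDiff ℝ (⊤ : ℕ∞) χ := χ.contDiff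
  have hs : ∀ k : ℕ, HasCompactSupport (iteratedDeriv k χ) := by
    intro k
    induction k with
    | zero => simpa using χ.hasCompactSupport
    | succ k ih => rw [iteratedDeriv_succ]; exact ih.deriv
  have hcc : ∀ k : ℕ, Continuous (iteratedDeriv k χ) := fun k =>
    hc.continuous_iteratedDeriv k (by exact_mod_cast le_top)
  have hd : ∀ (k : ℕ) (x : ℝ), HasDerivAt (iteratedDeriv k χ) (iteratedDeriv (k + 1) χ x) x := by
    intro k x
    rw [iteratedDeriv_succ]
    exact (hc.differentiable_iteratedDeriv k (by exact_mod_cast ENat.natCast_lt_top k) x).hasDerivAt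
  have hb : ∀ k : ℕ, ∃ L, ∀ x, |iteratedDeriv k χ x| ≤ L := fun k =>
    (hs k).exists_bound_of_continuous (hcc k)
  have hz : ∀ (k : ℕ) (x : ℝ), 3 ≤ |x| → iteratedDeriv k χ x = 0 := by
    intro k x hx
    have hsub : tsupport (iteratedDeriv k χ) ⊆ Metric.closedBall 0 2 := by
      induction k with
      | zero => simpa using χ.tsupport_eq.subset
      | succ k ih => rw [iteratedDeriv_succ]; exact (tsupport_deriv_subset).trans ih
    refine image_eq_zero_of_notMem_tsupport fun hmem => ?_
    have := hsub hmem
    rw [Metric.mem_closedBall, Real.dist_eq, sub_zero] at this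
    linarith
  choose L hL using hb
  have m : ∀ k, k < 4 → L k ≤ max (max (L 0) (L 1)) (max (L 2) (L 3)) := by
    intro k hk
    interval_cases k <;> simp
  refine ⟨iteratedDeriv 0 χ, iteratedDeriv 1 χ, iteratedDeriv 2 χ, iteratedDeriv 3 χ, _,
    ⟨hd 0, hd 1, hd 2, hcc 0, hcc 1, hcc 2, hcc 3, fun x => (hL 0 x).trans (m 0 (by simp)),
      fun x => (hL 1 x).trans (m 1 (by simp)), fun x => (hL 2 x).trans (m 2 (by simp)),
      fun x => (hL 3 x).trans (m 3 (by simp))⟩, ?_,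
    fun x hx => ⟨hz 0 x hx, hz 1 x hx, hz 2 x hx, hz 3 x hx⟩⟩
  simpa using χ.one_of_mem_closedBall (by simp [χ.rIn_pos.le])

/-- Approximation of a bounded weight by compactly supported ones. -/
lemma BoundedWeight.exists_compact_approx {φ₀ φ₁ φ₂ φ₃ : ℝ → ℝ} {M : ℝ}
    (w : BoundedWeight φ₀ φ₁ φ₂ φ₃ M) :
    ∃ (ψ₀ ψ₁ ψ₂ ψ₃ : ℕ → ℝ → ℝ) (R : ℕ → ℝ) (L : ℝ),
      (∀ n, BoundedWeight (ψ₀ n) (ψ₁ n) (ψ₂ n) (ψ₃ n) L) ∧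
      (∀ n x, R n ≤ |x| → ψ₀ n x = 0 ∧ ψ₁ n x = 0 ∧ ψ₂ n x = 0 ∧ ψ₃ n x = 0) ∧
      ∀ x, Tendsto (fun n => ψ₀ n x) atTop (𝓝 (φ₀ x)) ∧
        Tendsto (fun n => ψ₁ n x) atTop (𝓝 (φ₁ x)) ∧
        Tendsto (fun n => ψ₂ n x) atTop (𝓝 (φ₂ x)) ∧
        Tendsto (fun n => ψ₃ n x) atTop (𝓝 (φ₃ x)) := by
  obtain ⟨χ₀, χ₁, χ₂, χ₃, L, hχ, hone, hz⟩ := exists_cutoff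
  obtain ⟨e₀, e₁, e₂, k₀, k₁, k₂, k₃, l₀, l₁, l₂, l₃⟩ := hχ
  obtain ⟨d₀, d₁, d₂, c₀, c₁, c₂, c₃, m₀, m₁, m₂, m₃⟩ := w
  let c : ℕ → ℝ := fun n => 1 / ((n : ℝ) + 1)
  have hc0 : ∀ n, 0 < c n := fun n => by positivity
  have hc1 : ∀ n, c n ≤ 1 := fun n => by
    rw [div_le_one (by positivity)]; linarith [(Nat.cast_nonneg n : (0 : ℝ) ≤ n)]
  have hclim : Tendsto c atTop (𝓝 0) := tendsto_one_div_add_atTop_nhds_zero_nat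
  have hM : 0 ≤ M := (abs_nonneg _).trans (m₀ 0)
  have hL : 0 ≤ L := (abs_nonneg _).trans (l₀ 0)
  have scale : ∀ {f f' : ℝ → ℝ}, (∀ x, HasDerivAt f (f' x) x) → ∀ n x,
      HasDerivAt (fun y => f (c n * y)) (c n * f' (c n * x)) x := by
    intro f f' hf n x
    have := (hf (c n * x)).comp x ((hasDerivAt_id x).const_mul (c n))
    refine this.congr_deriv ?_
    simp [mul_comm]
  have prod : ∀ {f g : ℝ → ℝ}, (∀ x, |f x| ≤ M) → (∀ x, |g x| ≤ L) → ∀ n x (k : ℕ),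
      |c n ^ k * (f x * g (c n * x))| ≤ M * L := by
    intro f g hf hg n x k
    rw [abs_mul, abs_mul, abs_of_nonneg (by have := hc0 n; positivity)]
    calc c n ^ k * (|f x| * |g (c n * x)|) ≤ 1 * (M * L) := by
          gcongr
          · exact pow_le_one₀ (hc0 n).le (hc1 n)
          · exact hf x
          · exact hg _
      _ = M * L := one_mul _
  refine ⟨fun n x => φ₀ x * χ₀ (c n * x),
    fun n x => φ₁ x * χ₀ (c n * x) + c n * (φ₀ x * χ₁ (c n * x)),
    fun n x => φ₂ x * χ₀ (c n * x) + 2 * (c n * (φ₁ x * χ₁ (c n * x)))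
      + c n ^ 2 * (φ₀ x * χ₂ (c n * x)),
    fun n x => φ₃ x * χ₀ (c n * x) + 3 * (c n * (φ₂ x * χ₁ (c n * x)))
      + 3 * (c n ^ 2 * (φ₁ x * χ₂ (c n * x))) + c n ^ 3 * (φ₀ x * χ₃ (c n * x)),
    fun n => 3 / c n, 8 * (M * L), fun n => ?_, fun n x hx => ?_, fun x => ?_⟩
  · have hML : 0 ≤ M * L := by positivity
    refine ⟨fun x => ?_, fun x => ?_, fun x => ?_, by fun_prop, by fun_prop, by fun_prop,
      by fun_prop, fun x => ?_, fun x => ?_, fun x => ?_, fun x => ?_⟩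
    · refine ((d₀ x).mul (scale e₀ n x)).congr_deriv ?_
      ring
    · refine (((d₁ x).mul (scale e₀ n x)).add
        (((d₀ x).mul (scale e₁ n x)).const_mul (c n))).congr_deriv ?_
      ring
    · refine ((((d₂ x).mul (scale e₀ n x)).add
        ((((d₁ x).mul (scale e₁ n x)).const_mul (c n)).const_mul 2)).add
        (((d₀ x).mul (scale e₂ n x)).const_mul (c n ^ 2))).congr_deriv ?_
      ring
    · have h1 := abs_le.1 (prod m₀ l₀ n x 0)
      rw [abs_le]; constructor <;> linarith
    · have h1 := abs_le.1 (prod m₁ l₀ n x 0)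
      have h2 := abs_le.1 (prod m₀ l₁ n x 1)
      rw [abs_le]; constructor <;> linarith
    · have h1 := abs_le.1 (prod m₂ l₀ n x 0)
      have h2 := abs_le.1 (prod m₁ l₁ n x 1)
      have h3 := abs_le.1 (prod m₀ l₂ n x 2)
      rw [abs_le]; constructor <;> linarith
    · have h1 := abs_le.1 (prod m₃ l₀ n x 0)
      have h2 := abs_le.1 (prod m₂ l₁ n x 1)
      have h3 := abs_le.1 (prod m₁ l₂ n x 2)
      have h4 := abs_le.1 (prod m₀ l₃ n x 3)
      rw [abs_le]; constructor <;> linarith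
  · have h3 : 3 ≤ |c n * x| := by
      rw [abs_mul, abs_of_pos (hc0 n)]
      rwa [div_le_iff₀' (hc0 n)] at hx
    obtain ⟨z₀, z₁, z₂, z₃⟩ := hz _ h3
    simp [z₀, z₁, z₂, z₃]
  · have lim : ∀ {f : ℝ → ℝ}, Continuous f → Tendsto (fun n => f (c n * x)) atTop (𝓝 (f 0)) := by
      intro f hf
      have : Tendsto (fun n => c n * x) atTop (𝓝 0) := by simpa using hclim.mul_const x
      exact (hf.tendsto 0).comp this
    have t₀ := lim k₀
    rw [hone] at t₀
    have t₁ := lim k₁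
    have t₂ := lim k₂
    have t₃ := lim k₃
    refine ⟨?_, ?_, ?_, ?_⟩
    · simpa using t₀.const_mul (φ₀ x)
    · simpa using (t₀.const_mul (φ₁ x)).add (hclim.mul (t₁.const_mul (φ₀ x)))
    · simpa using ((t₀.const_mul (φ₂ x)).add ((hclim.mul (t₁.const_mul (φ₁ x))).const_mul 2)).add
        ((hclim.pow 2).mul (t₂.const_mul (φ₀ x)))
    · simpa using (((t₀.const_mul (φ₃ x)).add
        ((hclim.mul (t₁.const_mul (φ₂ x))).const_mul 3)).add
        (((hclim.pow 2).mul (t₂.const_mul (φ₁ x))).const_mul 3)).add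
        ((hclim.pow 3).mul (t₃.const_mul (φ₀ x)))

/-- The weighted balance law over the whole line and a time interval, valid as soon as the source
and the flux are bounded in `L¹` on that time interval. -/
lemma FluxLaw.integral_sub_eq {F T S A a B b C : ℝ → ℝ → ℝ} (h : FluxLaw F T S A a B b C)
    {φ₀ φ₁ φ₂ φ₃ : ℝ → ℝ} {M : ℝ} (w : BoundedWeight φ₀ φ₁ φ₂ φ₃ M) {s t K : ℝ}
    {g : ℝ → ℝ → ℝ} (hg : ∀ τ ∈ Set.uIcc s t, Integrable (g τ))
    (hK : ∀ τ ∈ Set.uIcc s t, ∫ x, g τ x ≤ K)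
    (hS : ∀ τ ∈ Set.uIcc s t, ∀ x, |S τ x| ≤ g τ x)
    (ha : ∀ τ ∈ Set.uIcc s t, ∀ x, |a τ x| ≤ g τ x)
    (hb : ∀ τ ∈ Set.uIcc s t, ∀ x, |b τ x| ≤ g τ x)
    (hC : ∀ τ ∈ Set.uIcc s t, ∀ x, |C τ x| ≤ g τ x)
    (hFs : Integrable (F s)) (hFt : Integrable (F t)) :
    (∫ x, F t x * φ₀ x) - ∫ x, F s x * φ₀ x
      = ∫ τ in s..t, ∫ x, (S τ x * φ₀ x - a τ x * φ₁ x + b τ x * φ₂ x - C τ x * φ₃ x) := by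
  obtain ⟨ψ₀, ψ₁, ψ₂, ψ₃, R, L, hψ, hz, hlim⟩ := w.exists_compact_approx
  have cF := h.cF
  have cS := h.cS
  have ca := h.ca
  have cb := h.cb
  have cC := h.cC
  have hsupp : ∀ (n : ℕ) (f : ℝ → ℝ), (∀ x, R n ≤ |x| → f x = 0) →
      ∫ x in (-R n)..R n, f x = ∫ x, f x := by
    intro n f hf
    refine intervalIntegral.integral_eq_integral_of_support_subset fun x hx => ?_
    have : |x| < R n := by
      by_contra hcon
      exact hx (hf x (not_lt.1 hcon))
    exact ⟨(abs_lt.1 this).1, (abs_lt.1 this).2.le⟩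
  have hL : 0 ≤ L := (abs_nonneg _).trans ((hψ 0).le₀ 0)
  have limF : ∀ r, Integrable (F r) →
      Tendsto (fun n => ∫ x, F r x * ψ₀ n x) atTop (𝓝 (∫ x, F r x * φ₀ x)) := by
    intro r hr
    refine tendsto_integral_of_dominated_convergence (fun x => |F r x| * L) (fun n => ?_)
      (hr.abs.mul_const L) (fun n => ?_) (ae_of_all _ fun x => (hlim x).1.const_mul _)
    · have := (hψ n).c₀
      exact Continuous.aestronglyMeasurable (by fun_prop)
    · refine ae_of_all _ fun x => ?_
      rw [Real.norm_eq_abs, abs_mul]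
      exact mul_le_mul_of_nonneg_left ((hψ n).le₀ x) (abs_nonneg _)
  let G : ℕ → ℝ → ℝ → ℝ := fun n τ x =>
    S τ x * ψ₀ n x - a τ x * ψ₁ n x + b τ x * ψ₂ n x - C τ x * ψ₃ n x
  have cG : ∀ n, Continuous (Function.uncurry (G n)) := fun n => by
    have := (hψ n).c₀
    have := (hψ n).c₁
    have := (hψ n).c₂
    have := (hψ n).c₃
    fun_prop
  have zG : ∀ n τ x, R n ≤ |x| → G n τ x = 0 := by
    intro n τ x hx
    obtain ⟨z₀, z₁, z₂, z₃⟩ := hz n x hx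
    simp [G, z₀, z₁, z₂, z₃]
  have bG : ∀ n, ∀ τ ∈ Set.uIcc s t, ∀ x, ‖G n τ x‖ ≤ g τ x * (4 * L) := by
    intro n τ hτ x
    have m : ∀ {p q : ℝ}, |p| ≤ g τ x → |q| ≤ L → |p * q| ≤ g τ x * L := by
      intro p q hp hq
      rw [abs_mul]
      exact mul_le_mul hp hq (abs_nonneg _) ((abs_nonneg _).trans hp)
    have i₀ := abs_le.1 (m (hS τ hτ x) ((hψ n).le₀ x))
    have i₁ := abs_le.1 (m (ha τ hτ x) ((hψ n).le₁ x))
    have i₂ := abs_le.1 (m (hb τ hτ x) ((hψ n).le₂ x))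
    have i₃ := abs_le.1 (m (hC τ hτ x) ((hψ n).le₃ x))
    rw [Real.norm_eq_abs, abs_le]
    constructor <;> linarith
  have eq : ∀ n, (∫ x, F t x * ψ₀ n x) - ∫ x, F s x * ψ₀ n x
      = ∫ τ in s..t, ∫ x, G n τ x := by
    intro n
    have := h.intervalIntegral_eq (hψ n) (fun x hx => (hz n x hx).1) (fun x hx => (hz n x hx).2.1)
      (fun x hx => (hz n x hx).2.2.1) s t
    rw [hsupp n _ fun x hx => by rw [(hz n x hx).1, mul_zero],
      hsupp n _ fun x hx => by rw [(hz n x hx).1, mul_zero]] at this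
    rw [this]
    exact intervalIntegral.integral_congr fun τ _ => hsupp n _ (zG n τ)
  refine tendsto_nhds_unique ((limF t hFt).sub (limF s hFs)) ?_
  simp_rw [eq]
  refine intervalIntegral.tendsto_integral_filter_of_dominated_convergence (fun _ => K * (4 * L))
    (Eventually.of_forall fun n => ?_) (Eventually.of_forall fun n => ?_)
    intervalIntegrable_const (ae_of_all _ fun τ hτ => ?_)
  · have : Continuous fun τ => ∫ x in (-R n)..R n, G n τ x :=
      intervalIntegral.continuous_parametric_intervalIntegral_of_continuous' (cG n) _ _
    refine (this.congr fun τ => ?_).aestronglyMeasurable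
    exact hsupp n _ (zG n τ)
  · refine ae_of_all _ fun τ hτ => ?_
    have hτ' := Set.uIoc_subset_uIcc hτ
    refine (norm_integral_le_of_norm_le ((hg τ hτ').mul_const (4 * L))
      (ae_of_all _ (bG n τ hτ'))).trans ?_
    rw [integral_mul_const]
    exact mul_le_mul_of_nonneg_right (hK τ hτ') (by positivity)
  · have hτ' := Set.uIoc_subset_uIcc hτ
    refine tendsto_integral_of_dominated_convergence (fun x => g τ x * (4 * L)) (fun n => ?_)
      ((hg τ hτ').mul_const _) (fun n => ae_of_all _ (bG n τ hτ')) (ae_of_all _ fun x => ?_)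
    · have := cG n
      exact Continuous.aestronglyMeasurable (by fun_prop)
    · obtain ⟨l₀, l₁, l₂, l₃⟩ := hlim x
      exact ((((l₀.const_mul _).sub (l₁.const_mul _)).add (l₂.const_mul _)).sub (l₃.const_mul _))

/-- If on every interval where `N` is bounded its values are controlled by any one of them,
then a lower semicontinuous `N` is locally bounded. -/
lemma LowerSemicontinuous.locally_bddAbove {N : ℝ → ℝ} (hN : LowerSemicontinuous N)
    (hprop : ∀ c, ∃ c', ∀ s r, BddAbove (N '' Set.uIcc s r) → N s ≤ c → N r ≤ c') (t : ℝ) :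
    ∃ c, ∀ᶠ τ in 𝓝 t, N τ ≤ c := by
  let U : Set ℝ := {t | ∃ c, ∀ᶠ τ in 𝓝 t, N τ ≤ c}
  have hU : IsOpen U := by
    rw [isOpen_iff_mem_nhds]
    rintro x ⟨c, hc⟩
    filter_upwards [hc.eventually_nhds] with y hy using ⟨c, hy⟩
  have bdd_of_subset : ∀ s r, Set.uIcc s r ⊆ U → BddAbove (N '' Set.uIcc s r) := by
    intro s r hsub
    refine isCompact_uIcc.induction_on (p := fun A => BddAbove (N '' A)) (by simp)
      (fun A B hAB hB => hB.mono (Set.image_mono hAB))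
      (fun A B hA hB => by rw [Set.image_union]; exact hA.union hB) fun x hx => ?_
    obtain ⟨c, hc⟩ := hsub hx
    exact ⟨_, mem_nhdsWithin_of_mem_nhds hc, c, by rintro _ ⟨y, hy, rfl⟩; exact hy⟩
  suffices hK : ¬ (Uᶜ).Nonempty by
    have : t ∈ U := by
      by_contra ht
      exact hK ⟨t, ht⟩
    exact this
  rintro hne
  have hKc : IsClosed Uᶜ := hU.isClosed_compl
  have : CompleteSpace (Uᶜ : Set ℝ) := hKc.completeSpace_coe
  have : Nonempty (Uᶜ : Set ℝ) := hne.to_subtype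
  obtain ⟨n, t₀, ht₀⟩ := nonempty_interior_of_iUnion_of_closed
    (f := fun n : ℕ => {x : (Uᶜ : Set ℝ) | N x ≤ n})
    (fun n => (hN.isClosed_preimage (n : ℝ)).preimage continuous_subtype_val)
    (Set.eq_univ_of_forall fun x => Set.mem_iUnion.2 (exists_nat_ge (N x)))
  obtain ⟨ε, hε, hball⟩ := Metric.isOpen_iff.1 isOpen_interior t₀ ht₀
  have hbd : ∀ y ∈ Uᶜ, |y - t₀| < ε → N y ≤ n := by
    intro y hy hd
    have : (⟨y, hy⟩ : (Uᶜ : Set ℝ)) ∈ Metric.ball t₀ ε := by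
      rw [Metric.mem_ball, Subtype.dist_eq, Real.dist_eq]; exact hd
    have hmem := interior_subset (hball this)
    exact hmem
  obtain ⟨c', hc'⟩ := hprop n
  -- from a bad time `b`, reached from `r` through good times only, `N` is controlled at `r`
  have ctrl : ∀ r b, b ∈ Uᶜ → |b - t₀| < ε → (∀ y ∈ Set.uIcc r b, y ≠ b → y ∈ U) →
      N r ≤ c' := by
    intro r b hb hbε hgood
    obtain ⟨d, hd⟩ := hprop (N r)
    refine hc' b r ⟨max d n, ?_⟩ (hbd b hb hbε)
    rintro _ ⟨y, hy, rfl⟩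
    rw [Set.uIcc_comm] at hy
    rcases eq_or_ne y b with rfl | hyb
    · exact le_max_of_le_right (hbd _ hb hbε)
    · refine le_max_of_le_left (hd r y (bdd_of_subset r y fun z hz => ?_) le_rfl)
      refine hgood z (Set.uIcc_subset_uIcc_left hy hz) ?_
      rintro rfl
      apply hyb
      rcases Set.mem_uIcc.1 hy with h1 | h1 <;> rcases Set.mem_uIcc.1 hz with h2 | h2 <;> linarith
  refine t₀.2 ⟨max c' n, ?_⟩
  filter_upwards [Metric.ball_mem_nhds (t₀ : ℝ) hε] with r hr
  rw [Metric.mem_ball, Real.dist_eq] at hr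
  by_cases hrU : r ∈ U
  swap
  · exact le_max_of_le_right (hbd r hrU hr)
  refine le_max_of_le_left ?_
  rcases le_total r t₀ with hrt | hrt
  · have hcomp : IsCompact (Uᶜ ∩ Set.Icc r t₀) := isCompact_Icc.inter_left hKc
    obtain ⟨b, ⟨hbK, hb⟩, hleast⟩ := hcomp.exists_isLeast ⟨t₀, t₀.2, hrt, le_rfl⟩
    refine ctrl r b hbK ?_ fun y hy hyb => ?_
    · rw [abs_lt] at hr ⊢
      constructor <;> linarith [hb.1, hb.2]
    · by_contra hyU
      rw [Set.uIcc_of_le hb.1] at hy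
      exact hyb (le_antisymm hy.2 (hleast ⟨hyU, hy.1, hy.2.trans hb.2⟩))
  · have hcomp : IsCompact (Uᶜ ∩ Set.Icc (t₀ : ℝ) r) := isCompact_Icc.inter_left hKc
    obtain ⟨b, ⟨hbK, hb⟩, hgreatest⟩ := hcomp.exists_isGreatest ⟨t₀, t₀.2, le_rfl, hrt⟩
    refine ctrl r b hbK ?_ fun y hy hyb => ?_
    · rw [abs_lt] at hr ⊢
      constructor <;> linarith [hb.1, hb.2]
    · by_contra hyU
      rw [Set.uIcc_of_ge hb.2] at hy
      exact hyb (le_antisymm (hgreatest ⟨hyU, hb.1.trans hy.1, hy.2⟩) hy.1)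

/-- Integrals of a nonnegative continuous integrand are lower semicontinuous in the parameter. -/
lemma lowerSemicontinuousAt_integral_of_nonneg {H : ℝ → ℝ → ℝ} {t : ℝ}
    (cH : Continuous (Function.uncurry H)) (h0 : ∀ᶠ τ in 𝓝 t, ∀ x, 0 ≤ H τ x)
    (hi : ∀ t, Integrable (H t)) :
    LowerSemicontinuousAt (fun t => ∫ x, H t x) t := by
  intro y hy
  have lim := intervalIntegral_tendsto_integral (hi t) tendsto_neg_atTop_atBot tendsto_id
  obtain ⟨R, hR, hR0⟩ := ((lim.eventually_const_lt hy).and (eventually_ge_atTop 0)).exists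
  have hc : Continuous fun t => ∫ x in (-R)..R, H t x :=
    intervalIntegral.continuous_parametric_intervalIntegral_of_continuous' cH _ _
  filter_upwards [(hc.tendsto t).eventually_const_lt hR, h0] with τ hτ h0τ
  refine hτ.trans_le ?_
  rw [intervalIntegral.integral_of_le (by linarith [show (0 : ℝ) ≤ R from hR0])]
  exact setIntegral_le_integral (hi τ) (ae_of_all _ h0τ)

/-- `J` is bounded by a constant multiple of `H` for times in `I`. -/
def DominatedOn (I : Set ℝ) (J H : ℝ → ℝ → ℝ) : Prop :=
  ∃ c, 0 ≤ c ∧ ∀ τ ∈ I, ∀ x, |J τ x| ≤ c * H τ x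

namespace DominatedOn

variable {I : Set ℝ} {J J' H H' : ℝ → ℝ → ℝ}

lemma add (h : DominatedOn I J H) (h' : DominatedOn I J' H) :
    DominatedOn I (fun τ x => J τ x + J' τ x) H := by
  obtain ⟨c, hc, h⟩ := h
  obtain ⟨c', hc', h'⟩ := h'
  refine ⟨c + c', by positivity, fun τ hτ x => ?_⟩
  rw [add_mul]
  exact (abs_add_le _ _).trans (add_le_add (h τ hτ x) (h' τ hτ x))

lemma const_mul (h : DominatedOn I J H) (k : ℝ) : DominatedOn I (fun τ x => k * J τ x) H := by
  obtain ⟨c, hc, h⟩ := h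
  refine ⟨|k| * c, by positivity, fun τ hτ x => ?_⟩
  rw [abs_mul, mul_assoc]
  exact mul_le_mul_of_nonneg_left (h τ hτ x) (abs_nonneg _)

lemma sub (h : DominatedOn I J H) (h' : DominatedOn I J' H) :
    DominatedOn I (fun τ x => J τ x - J' τ x) H := by
  simpa [sub_eq_add_neg] using h.add (h'.const_mul (-1))

lemma mul (h : DominatedOn I J H) (h' : DominatedOn I J' H') :
    DominatedOn I (fun τ x => J τ x * J' τ x) (fun τ x => H τ x * H' τ x) := by
  obtain ⟨c, hc, h⟩ := h
  obtain ⟨c', hc', h'⟩ := h'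
  refine ⟨c * c', by positivity, fun τ hτ x => ?_⟩
  rw [abs_mul]
  calc |J τ x| * |J' τ x| ≤ (c * H τ x) * (c' * H' τ x) :=
        mul_le_mul (h τ hτ x) (h' τ hτ x) (abs_nonneg _) ((abs_nonneg _).trans (h τ hτ x))
    _ = c * c' * (H τ x * H' τ x) := by ring

lemma congr (h : DominatedOn I J H) (e : ∀ τ x, J τ x = J' τ x) : DominatedOn I J' H := by
  obtain ⟨c, hc, h⟩ := h
  exact ⟨c, hc, fun τ hτ x => e τ x ▸ h τ hτ x⟩

lemma mul_bounded (h : DominatedOn I J H) (h' : DominatedOn I J' fun _ _ => 1) :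
    DominatedOn I (fun τ x => J' τ x * J τ x) H := by
  simpa using h'.mul h

lemma mono_set {I' : Set ℝ} (h : DominatedOn I J H) (hI : I' ⊆ I) : DominatedOn I' J H := by
  obtain ⟨c, hc, h⟩ := h
  exact ⟨c, hc, fun τ hτ x => h τ (hI hτ) x⟩

lemma integrable (h : DominatedOn I J H) (cJ : Continuous (Function.uncurry J)) {τ : ℝ}
    (hτ : τ ∈ I) (hH : Integrable (H τ)) : Integrable (J τ) := by
  obtain ⟨c, hc, h⟩ := h
  exact (hH.const_mul c).mono' (Continuous.aestronglyMeasurable (by fun_prop))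
    (ae_of_all _ fun x => h τ hτ x)

lemma mul_of_sq_le {f g : ℝ → ℝ → ℝ} (hf : ∀ τ x, f τ x ^ 2 ≤ 2 * H τ x)
    (hg : ∀ τ x, g τ x ^ 2 ≤ 2 * H τ x) : DominatedOn I (fun τ x => f τ x * g τ x) H := by
  refine ⟨2, zero_le_two, fun τ _ x => ?_⟩
  rw [abs_le]
  constructor <;> nlinarith [hf τ x, hg τ x, sq_nonneg (f τ x + g τ x), sq_nonneg (f τ x - g τ x)]

lemma exists_abs_integral_le (h : DominatedOn I J H) {K : ℝ} (hH : ∀ τ, Integrable (H τ))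
    (hK : ∀ τ ∈ I, ∫ x, H τ x ≤ K) : ∃ c, ∀ τ ∈ I, |∫ x, J τ x| ≤ c := by
  obtain ⟨c, hc, h⟩ := h
  refine ⟨c * K, fun τ hτ => ?_⟩
  have hle : ‖∫ x, J τ x‖ ≤ ∫ x, c * H τ x :=
    norm_integral_le_of_norm_le ((hH τ).const_mul c) (ae_of_all _ fun x => h τ hτ x)
  refine hle.trans ?_
  rw [integral_const_mul]
  exact mul_le_mul_of_nonneg_left (hK τ hτ) hc

lemma zero (H0 : ∀ τ x, 0 ≤ H τ x) : DominatedOn I (fun _ _ => 0) H :=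
  ⟨1, zero_le_one, fun τ _ x => by simpa using H0 τ x⟩

end DominatedOn

/-- The weighted balance law when the source and the flux are dominated by a nonnegative function
that is bounded in `L¹` on the time interval. -/
lemma FluxLaw.integral_sub_eq_of_dominated {F T S A a B b C : ℝ → ℝ → ℝ}
    (h : FluxLaw F T S A a B b C) {φ₀ φ₁ φ₂ φ₃ : ℝ → ℝ} {M : ℝ}
    (w : BoundedWeight φ₀ φ₁ φ₂ φ₃ M) {s t K : ℝ} {H : ℝ → ℝ → ℝ} (H0 : ∀ τ x, 0 ≤ H τ x)
    (hH : ∀ τ, Integrable (H τ)) (hK : ∀ τ ∈ Set.uIcc s t, ∫ x, H τ x ≤ K)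
    (hS : DominatedOn (Set.uIcc s t) S H) (ha : DominatedOn (Set.uIcc s t) a H)
    (hb : DominatedOn (Set.uIcc s t) b H) (hC : DominatedOn (Set.uIcc s t) C H)
    (hF : ∀ τ, Integrable (F τ)) :
    (∫ x, F t x * φ₀ x) - ∫ x, F s x * φ₀ x
      = ∫ τ in s..t, ∫ x, (S τ x * φ₀ x - a τ x * φ₁ x + b τ x * φ₂ x - C τ x * φ₃ x) := by
  obtain ⟨c₁, p₁, hS⟩ := hS
  obtain ⟨c₂, p₂, ha⟩ := ha
  obtain ⟨c₃, p₃, hb⟩ := hb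
  obtain ⟨c₄, p₄, hC⟩ := hC
  refine h.integral_sub_eq w (g := fun τ x => (c₁ + c₂ + c₃ + c₄) * H τ x)
    (K := (c₁ + c₂ + c₃ + c₄) * K) (fun τ _ => (hH τ).const_mul _) (fun τ hτ => ?_)
    (fun τ hτ x => (hS τ hτ x).trans ?_) (fun τ hτ x => (ha τ hτ x).trans ?_)
    (fun τ hτ x => (hb τ hτ x).trans ?_) (fun τ hτ x => (hC τ hτ x).trans ?_) (hF s) (hF t)
  · rw [integral_const_mul]
    exact mul_le_mul_of_nonneg_left (hK τ hτ) (by positivity)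
  all_goals exact mul_le_mul_of_nonneg_right (by linarith) (H0 τ x)

/-- The unweighted form of `FluxLaw.integral_sub_eq_of_dominated`. -/
lemma FluxLaw.integral_sub_eq_one_of_dominated {F T S A a B b C : ℝ → ℝ → ℝ}
    (h : FluxLaw F T S A a B b C) {s t K : ℝ} {H : ℝ → ℝ → ℝ} (H0 : ∀ τ x, 0 ≤ H τ x)
    (hH : ∀ τ, Integrable (H τ)) (hK : ∀ τ ∈ Set.uIcc s t, ∫ x, H τ x ≤ K)
    (hS : DominatedOn (Set.uIcc s t) S H) (ha : DominatedOn (Set.uIcc s t) a H)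
    (hb : DominatedOn (Set.uIcc s t) b H) (hC : DominatedOn (Set.uIcc s t) C H)
    (hF : ∀ τ, Integrable (F τ)) :
    (∫ x, F t x) - ∫ x, F s x = ∫ τ in s..t, ∫ x, S τ x := by
  have w : BoundedWeight (fun _ => 1) (fun _ => 0) (fun _ => 0) (fun _ => 0) 1 := by
    refine ⟨fun x => hasDerivAt_const x 1, fun x => hasDerivAt_const x 0,
      fun x => hasDerivAt_const x 0, by fun_prop, by fun_prop, by fun_prop, by fun_prop,
      ?_, ?_, ?_, ?_⟩ <;> simp
  simpa using h.integral_sub_eq_of_dominated w H0 hH hK hS ha hb hC hF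

/-- `u` solves the mKdV equation, `p`, `q`, `r`, `z` are its successive `x`-derivatives, and
`u`, `p`, `q` decay at each time. -/
structure DecayingMKdV (u p q r z : ℝ → ℝ → ℝ) : Prop where
  cu : Continuous (Function.uncurry u)
  cp : Continuous (Function.uncurry p)
  cq : Continuous (Function.uncurry q)
  cr : Continuous (Function.uncurry r)
  cz : Continuous (Function.uncurry z)
  xu : ∀ t x, HasDerivAt (u t) (p t x) x
  xp : ∀ t x, HasDerivAt (p t) (q t x) x
  xq : ∀ t x, HasDerivAt (q t) (r t x) x
  xr : ∀ t x, HasDerivAt (r t) (z t x) x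
  tu : ∀ t x, HasDerivAt (fun s => u s x) (-(r t x + 3 * u t x ^ 2 * p t x)) t
  tp : ∀ t x, HasDerivAt (fun s => p s x)
    (-(z t x + 3 * u t x ^ 2 * q t x + 6 * u t x * p t x ^ 2)) t
  decu : ∀ t, ∃ c, ∀ x, |u t x| * (1 + x ^ 2) ≤ c
  decp : ∀ t, ∃ c, ∀ x, |p t x| * (1 + x ^ 2) ≤ c
  decq : ∀ t, ∃ c, ∀ x, |q t x| * (1 + x ^ 2) ≤ c

namespace DecayingMKdV

variable {u p q r z : ℝ → ℝ → ℝ}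

lemma massLaw (h : DecayingMKdV u p q r z) :
    FluxLaw (fun t x => 1 / 2 * u t x ^ 2)
      (fun t x => -(u t x * (r t x + 3 * u t x ^ 2 * p t x)))
      (fun _ _ => 0)
      (fun t x => -(u t x * q t x) + 1 / 2 * p t x ^ 2 - 3 / 4 * u t x ^ 4)
      (fun t x => -(u t x * q t x) + 1 / 2 * p t x ^ 2 - 3 / 4 * u t x ^ 4)
      (fun _ _ => 0) (fun _ _ => 0) (fun _ _ => 0) := by
  obtain ⟨cu, cp, cq, cr, cz, xu, xp, xq, xr, tu, tp, -, -, -⟩ := h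
  refine ⟨fun t x => ?_, fun t x => ?_, fun t x => ?_, fun t x => ?_, by fun_prop, by fun_prop,
    by fun_prop, by fun_prop, by fun_prop, by fun_prop⟩
  · refine (((tu t x).pow 2).const_mul (1 / 2)).congr_deriv ?_
    norm_num
    ring
  · refine (((((xu t x).mul (xq t x)).neg).add (((xp t x).pow 2).const_mul (1 / 2))).sub
      (((xu t x).pow 4).const_mul (3 / 4))).congr_deriv ?_
    norm_num
    ring
  · simpa using hasDerivAt_const x (0 : ℝ)
  · simpa using hasDerivAt_const x (0 : ℝ)

lemma energyLaw (h : DecayingMKdV u p q r z) :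
    FluxLaw (fun t x => 1 / 2 * p t x ^ 2 - 1 / 4 * u t x ^ 4)
      (fun t x => -(p t x * (z t x + 3 * u t x ^ 2 * q t x + 6 * u t x * p t x ^ 2))
        + u t x ^ 3 * (r t x + 3 * u t x ^ 2 * p t x))
      (fun _ _ => 0)
      (fun t x => -(p t x * (r t x + 3 * u t x ^ 2 * p t x)) + 1 / 2 * (q t x + u t x ^ 3) ^ 2)
      (fun t x => q t x ^ 2 - 3 * u t x ^ 2 * p t x ^ 2 + 1 / 2 * (q t x + u t x ^ 3) ^ 2)
      (fun t x => -(p t x * q t x)) (fun _ _ => 0) (fun t x => -(1 / 2 * p t x ^ 2)) := by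
  obtain ⟨cu, cp, cq, cr, cz, xu, xp, xq, xr, tu, tp, -, -, -⟩ := h
  refine ⟨fun t x => ?_, fun t x => ?_, fun t x => ?_, fun t x => ?_, by fun_prop, by fun_prop,
    by fun_prop, by fun_prop, by fun_prop, by fun_prop⟩
  · refine ((((tp t x).pow 2).const_mul (1 / 2)).sub
      (((tu t x).pow 4).const_mul (1 / 4))).congr_deriv ?_
    norm_num
    ring
  · refine ((((xp t x).mul ((xr t x).add
      ((((xu t x).pow 2).const_mul 3).mul (xp t x)))).neg).add
      ((((xq t x).add ((xu t x).pow 3)).pow 2).const_mul (1 / 2))).congr_deriv ?_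
    simp
    ring
  · refine (((xp t x).mul (xq t x)).neg).congr_deriv ?_
    ring
  · refine ((((xp t x).pow 2).const_mul (1 / 2)).neg).congr_deriv ?_
    norm_num
    ring

lemma gradientLaw (h : DecayingMKdV u p q r z) :
    FluxLaw (fun t x => 1 / 2 * p t x ^ 2)
      (fun t x => -(p t x * (z t x + 3 * u t x ^ 2 * q t x + 6 * u t x * p t x ^ 2)))
      (fun t x => -(6 * (u t x * p t x * (p t x * p t x)) + 3 * (u t x * u t x * (p t x * q t x))))
      (fun t x => -(p t x * r t x) + 1 / 2 * q t x ^ 2)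
      (fun t x => 3 / 2 * q t x ^ 2)
      (fun t x => -(p t x * q t x)) (fun _ _ => 0) (fun t x => -(1 / 2 * p t x ^ 2)) := by
  obtain ⟨cu, cp, cq, cr, cz, xu, xp, xq, xr, tu, tp, -, -, -⟩ := h
  refine ⟨fun t x => ?_, fun t x => ?_, fun t x => ?_, fun t x => ?_, by fun_prop, by fun_prop,
    by fun_prop, by fun_prop, by fun_prop, by fun_prop⟩
  · refine (((tp t x).pow 2).const_mul (1 / 2)).congr_deriv ?_
    norm_num
    ring
  · refine ((((xp t x).mul (xr t x)).neg).add
      (((xq t x).pow 2).const_mul (1 / 2))).congr_deriv ?_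
    norm_num
    ring
  · refine (((xp t x).mul (xq t x)).neg).congr_deriv ?_
    ring
  · refine ((((xp t x).pow 2).const_mul (1 / 2)).neg).congr_deriv ?_
    norm_num
    ring

/-- The lower order part of the second conserved energy. -/
lemma correctionLaw (h : DecayingMKdV u p q r z) :
    FluxLaw (fun t x => -(5 / 2) * (u t x ^ 2 * p t x ^ 2) + 1 / 4 * u t x ^ 6)
      (fun t x => 5 * u t x * p t x ^ 2 * (r t x + 3 * u t x ^ 2 * p t x)
        + 5 * u t x ^ 2 * p t x * (z t x + 3 * u t x ^ 2 * q t x + 6 * u t x * p t x ^ 2)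
        - 3 / 2 * u t x ^ 5 * (r t x + 3 * u t x ^ 2 * p t x))
      (fun t x => 15 * (u t x * p t x * (q t x * q t x)))
      (fun t x => 5 * (u t x ^ 2 * p t x * r t x) + 45 / 4 * (u t x ^ 4 * p t x ^ 2)
        - 5 * (u t x * p t x ^ 2 * q t x) + 5 / 4 * p t x ^ 4 - 5 / 2 * (u t x ^ 2 * q t x ^ 2)
        - 3 / 2 * (u t x ^ 5 * q t x) - 9 / 16 * u t x ^ 8)
      (fun t x => 45 / 4 * (u t x ^ 4 * p t x ^ 2)
        - 15 * (u t x * p t x ^ 2 * q t x) + 5 / 4 * p t x ^ 4 - 15 / 2 * (u t x ^ 2 * q t x ^ 2)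
        - 3 / 2 * (u t x ^ 5 * q t x) - 9 / 16 * u t x ^ 8)
      (fun t x => 5 * (u t x ^ 2 * p t x * q t x)) (fun t x => 5 * (u t x ^ 2 * p t x * q t x))
      (fun _ _ => 0) := by
  obtain ⟨cu, cp, cq, cr, cz, xu, xp, xq, xr, tu, tp, -, -, -⟩ := h
  refine ⟨fun t x => ?_, fun t x => ?_, fun t x => ?_, fun t x => ?_, by fun_prop, by fun_prop,
    by fun_prop, by fun_prop, by fun_prop, by fun_prop⟩
  · refine (((((tu t x).pow 2).mul ((tp t x).pow 2)).const_mul (-(5 / 2))).add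
      (((tu t x).pow 6).const_mul (1 / 4))).congr_deriv ?_
    simp
    ring
  · have U := xu t x
    have P := xp t x
    have Q := xq t x
    have R := xr t x
    refine (((((((((U.pow 2).mul P).mul R).const_mul 5).add
      (((U.pow 4).mul (P.pow 2)).const_mul (45 / 4))).sub
      (((U.mul (P.pow 2)).mul Q).const_mul 5)).add
      ((P.pow 4).const_mul (5 / 4))).sub
      (((U.pow 2).mul (Q.pow 2)).const_mul (5 / 2))).sub
      (((U.pow 5).mul Q).const_mul (3 / 2)) |>.sub
      ((U.pow 8).const_mul (9 / 16))).congr_deriv ?_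
    simp
    ring
  · refine (((((xu t x).pow 2).mul (xp t x)).mul (xq t x)).const_mul 5).congr_deriv ?_
    simp
    ring
  · simpa using hasDerivAt_const x (0 : ℝ)

/-- The balance law for the translation difference `p t (x + k) - p t x`. -/
lemma differenceLaw (h : DecayingMKdV u p q r z) (k : ℝ) :
    FluxLaw (fun t x => 1 / 2 * (p t (x + k) - p t x) ^ 2)
      (fun t x => (p t (x + k) - p t x)
        * (-(z t (x + k) + 3 * u t (x + k) ^ 2 * q t (x + k) + 6 * u t (x + k) * p t (x + k) ^ 2)
          + (z t x + 3 * u t x ^ 2 * q t x + 6 * u t x * p t x ^ 2)))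
      (fun t x => -(3 / 2 * (2 * u t (x + k) * p t (x + k) + p t (x + k) * u t x
            + u t (x + k) * p t x + 2 * u t x * p t x) * (p t (x + k) - p t x) ^ 2
        + (2 * p t (x + k) ^ 2 + 2 * u t (x + k) * q t (x + k) + q t (x + k) * u t x
            + 2 * p t (x + k) * p t x + u t (x + k) * q t x + 2 * p t x ^ 2 + 2 * u t x * q t x)
          * (u t (x + k) - u t x) * (p t (x + k) - p t x)))
      (fun t x => -((p t (x + k) - p t x) * (r t (x + k) - r t x))
        + 1 / 2 * (q t (x + k) - q t x) ^ 2
        - 1 / 2 * ((u t (x + k) ^ 2 + u t (x + k) * u t x + u t x ^ 2)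
          * (p t (x + k) - p t x) ^ 2))
      (fun t x => 3 / 2 * (q t (x + k) - q t x) ^ 2
        - 1 / 2 * ((u t (x + k) ^ 2 + u t (x + k) * u t x + u t x ^ 2)
          * (p t (x + k) - p t x) ^ 2))
      (fun t x => -((p t (x + k) - p t x) * (q t (x + k) - q t x)))
      (fun _ _ => 0) (fun t x => -(1 / 2 * (p t (x + k) - p t x) ^ 2)) := by
  obtain ⟨cu, cp, cq, cr, cz, xu, xp, xq, xr, tu, tp, -, -, -⟩ := h
  refine ⟨fun t x => ?_, fun t x => ?_, fun t x => ?_, fun t x => ?_, by fun_prop, by fun_prop,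
    by fun_prop, by fun_prop, by fun_prop, by fun_prop⟩
  · refine ((((tp t (x + k)).sub (tp t x)).pow 2).const_mul (1 / 2)).congr_deriv ?_
    simp
    ring
  all_goals
    have U := xu t x
    have P := xp t x
    have Q := xq t x
    have R := xr t x
    have U' := (xu t (x + k)).comp_add_const x k
    have P' := (xp t (x + k)).comp_add_const x k
    have Q' := (xq t (x + k)).comp_add_const x k
    have R' := (xr t (x + k)).comp_add_const x k
  · refine (((((P'.sub P).mul (R'.sub R)).neg).add
      (((Q'.sub Q).pow 2).const_mul (1 / 2))).sub
      (((((U'.pow 2).add (U'.mul U)).add (U.pow 2)).mul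
        ((P'.sub P).pow 2)).const_mul (1 / 2))).congr_deriv ?_
    simp
    ring
  · refine (((P'.sub P).mul (Q'.sub Q)).neg).congr_deriv ?_
    simp
    ring
  · refine ((((P'.sub P).pow 2).const_mul (1 / 2)).neg).congr_deriv ?_
    norm_num
    ring

end DecayingMKdV

/-- A weighted Agmon inequality. -/
lemma sq_le_integral_add_integral {f f' : ℝ → ℝ} (hf : ∀ x, HasDerivAt f (f' x) x)
    (cf' : Continuous f') (hlim : Tendsto f atBot (𝓝 0)) (i : Integrable fun x => f x ^ 2)
    (i' : Integrable fun x => f' x ^ 2) {ε : ℝ} (hε : 0 < ε) (x : ℝ) :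
    f x ^ 2 ≤ ε * (∫ y, f' y ^ 2) + ε⁻¹ * ∫ y, f y ^ 2 := by
  have cf : Continuous f := continuous_iff_continuousAt.2 fun x => (hf x).continuousAt
  have hd : ∀ y, HasDerivAt (fun y => f y ^ 2) (2 * f y * f' y) y := fun y =>
    ((hf y).pow 2).congr_deriv (by simp)
  have hle : ∀ y, |2 * f y * f' y| ≤ ε * f' y ^ 2 + ε⁻¹ * f y ^ 2 := by
    intro y
    have e : ε * ε⁻¹ = 1 := mul_inv_cancel₀ hε.ne'
    have h1 : ε * (f' y + ε⁻¹ * f y) ^ 2 = ε * f' y ^ 2 + ε⁻¹ * f y ^ 2 + 2 * f y * f' y := by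
      linear_combination (2 * f y * f' y + ε⁻¹ * f y ^ 2) * e
    have h2 : ε * (f' y - ε⁻¹ * f y) ^ 2 = ε * f' y ^ 2 + ε⁻¹ * f y ^ 2 - 2 * f y * f' y := by
      linear_combination (-2 * f y * f' y + ε⁻¹ * f y ^ 2) * e
    have p1 : 0 ≤ ε * (f' y + ε⁻¹ * f y) ^ 2 := by positivity
    have p2 : 0 ≤ ε * (f' y - ε⁻¹ * f y) ^ 2 := by positivity
    rw [abs_le]
    constructor <;> linarith
  have ig : Integrable fun y => ε * f' y ^ 2 + ε⁻¹ * f y ^ 2 := (i'.const_mul ε).add (i.const_mul _)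
  have id : Integrable fun y => 2 * f y * f' y :=
    ig.mono' (Continuous.aestronglyMeasurable (by fun_prop)) (ae_of_all _ hle)
  have hl : Tendsto (fun y => f y ^ 2) atBot (𝓝 0) := by simpa using hlim.pow 2
  have key := integral_Iic_of_hasDerivAt_of_tendsto' (a := x) (fun y _ => hd y) id.integrableOn hl
  have h0 : ∀ y, 0 ≤ ε * f' y ^ 2 + ε⁻¹ * f y ^ 2 := fun y => by positivity
  calc f x ^ 2 = ∫ y in Set.Iic x, 2 * f y * f' y := by rw [key]; ring
    _ ≤ ∫ y in Set.Iic x, (ε * f' y ^ 2 + ε⁻¹ * f y ^ 2) :=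
        integral_mono id.integrableOn ig.integrableOn fun y => (le_abs_self _).trans (hle y)
    _ ≤ ∫ y, (ε * f' y ^ 2 + ε⁻¹ * f y ^ 2) := setIntegral_le_integral ig (ae_of_all _ h0)
    _ = _ := by rw [integral_add (i'.const_mul ε) (i.const_mul _), integral_const_mul,
        integral_const_mul]

/-- Translation differences are controlled in `L²` by the derivative. -/
lemma integral_sq_sub_translate_le {f f' : ℝ → ℝ} (hf : ∀ x, HasDerivAt f (f' x) x)
    (cf' : Continuous f') (i' : Integrable fun x => f' x ^ 2) {k : ℝ} (hk : 0 ≤ k)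
    (i : Integrable fun x => (f (x + k) - f x) ^ 2) :
    ∫ x, (f (x + k) - f x) ^ 2 ≤ k ^ 2 * ∫ x, f' x ^ 2 := by
  have cf : Continuous f := continuous_iff_continuousAt.2 fun x => (hf x).continuousAt
  have hpt : ∀ x, (f (x + k) - f x) ^ 2 ≤ k * ∫ y in (0 : ℝ)..k, f' (x + y) ^ 2 := by
    intro x
    have e : f (x + k) - f x = ∫ y in (0 : ℝ)..k, f' (x + y) := by
      rw [intervalIntegral.integral_comp_add_left, add_zero]
      exact (intervalIntegral.integral_eq_sub_of_hasDerivAt (fun y _ => hf y)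
        (cf'.intervalIntegrable _ _)).symm
    rw [e]
    set m := ∫ y in (0 : ℝ)..k, f' (x + y) with hm
    have h0 : 0 ≤ ∫ y in (0 : ℝ)..k, (k * f' (x + y) - m) ^ 2 :=
      intervalIntegral.integral_nonneg hk fun y _ => sq_nonneg _
    have h1 : ∫ y in (0 : ℝ)..k, (k * f' (x + y) - m) ^ 2
        = k ^ 2 * (∫ y in (0 : ℝ)..k, f' (x + y) ^ 2) - k * m ^ 2 := by
      have : ∀ y, (k * f' (x + y) - m) ^ 2
          = k ^ 2 * f' (x + y) ^ 2 - 2 * k * m * f' (x + y) + m ^ 2 := fun y => by ring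
      simp_rw [this]
      rw [intervalIntegral.integral_add (Continuous.intervalIntegrable (by fun_prop) _ _)
        (Continuous.intervalIntegrable (by fun_prop) _ _),
        intervalIntegral.integral_sub (Continuous.intervalIntegrable (by fun_prop) _ _)
        (Continuous.intervalIntegrable (by fun_prop) _ _), intervalIntegral.integral_const_mul,
        intervalIntegral.integral_const_mul, intervalIntegral.integral_const, ← hm, sub_zero,
        smul_eq_mul]
      ring
    rcases hk.eq_or_lt with rfl | hk0
    · simp [hm]
    · rw [h1] at h0
      have : k * (k * (∫ y in (0 : ℝ)..k, f' (x + y) ^ 2) - m ^ 2) ≥ 0 := by linarith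
      linarith [nonneg_of_mul_nonneg_right this hk0]
  refine le_of_tendsto (intervalIntegral_tendsto_integral i tendsto_neg_atTop_atBot tendsto_id)
    ((eventually_ge_atTop 0).mono fun R hR => ?_)
  have hR' : -R ≤ R := by linarith [show (0 : ℝ) ≤ R from hR]
  have hc : Continuous fun x => ∫ y in (0 : ℝ)..k, f' (x + y) ^ 2 :=
    intervalIntegral.continuous_parametric_intervalIntegral_of_continuous'
      (f := fun x y => f' (x + y) ^ 2) (by fun_prop) _ _
  calc ∫ x in (-R)..R, (f (x + k) - f x) ^ 2
      ≤ ∫ x in (-R)..R, k * ∫ y in (0 : ℝ)..k, f' (x + y) ^ 2 :=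
        intervalIntegral.integral_mono_on hR' (Continuous.intervalIntegrable (by fun_prop) _ _)
          (Continuous.intervalIntegrable (by fun_prop) _ _) fun x _ => hpt x
    _ = k * ∫ y in (0 : ℝ)..k, ∫ x in (-R)..R, f' (x + y) ^ 2 := by
        rw [intervalIntegral.integral_const_mul,
          intervalIntegral_intervalIntegral_swap (F := fun x y => f' (x + y) ^ 2)
          ((Continuous.continuousOn (by fun_prop)).integrableOn_compact
            (isCompact_uIcc.prod isCompact_uIcc) |>.mono_set
            (Set.prod_mono Set.uIoc_subset_uIcc Set.uIoc_subset_uIcc))]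
    _ ≤ k * ∫ _ in (0 : ℝ)..k, ∫ x, f' x ^ 2 := by
        refine mul_le_mul_of_nonneg_left ?_ hk
        refine intervalIntegral.integral_mono_on hk (Continuous.intervalIntegrable ?_ _ _)
          (Continuous.intervalIntegrable (by fun_prop) _ _) fun y _ => ?_
        · exact intervalIntegral.continuous_parametric_intervalIntegral_of_continuous'
            (f := fun y x => f' (x + y) ^ 2) (by fun_prop) _ _
        · rw [← integral_add_right_eq_self (fun x => f' x ^ 2) y,
            intervalIntegral.integral_of_le hR']
          exact setIntegral_le_integral (i'.comp_add_right y) (ae_of_all _ fun x => sq_nonneg _)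
    _ = k ^ 2 * ∫ x, f' x ^ 2 := by
        rw [intervalIntegral.integral_const, smul_eq_mul]
        ring

/-- The `H²` density `u² + p² + q²`. -/
def sobolevDensity (u p q : ℝ → ℝ → ℝ) (t x : ℝ) : ℝ := u t x ^ 2 + p t x ^ 2 + q t x ^ 2

lemma sobolevDensity_nonneg (u p q : ℝ → ℝ → ℝ) (t x : ℝ) : 0 ≤ sobolevDensity u p q t x := by
  unfold sobolevDensity
  positivity

lemma integrable_sq_of_decay {f : ℝ → ℝ} (cf : Continuous f) {c : ℝ}
    (hc : ∀ x, |f x| * (1 + x ^ 2) ≤ c) : Integrable fun x => f x ^ 2 := by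
  refine (integrable_inv_one_add_sq.const_mul (c ^ 2)).mono'
    (Continuous.aestronglyMeasurable (by fun_prop)) (ae_of_all _ fun x => ?_)
  have hx : (0 : ℝ) < 1 + x ^ 2 := by positivity
  have h1 : 1 ≤ 1 + x ^ 2 := by linarith [sq_nonneg x]
  rw [Real.norm_eq_abs, abs_of_nonneg (sq_nonneg _), ← div_eq_mul_inv, le_div_iff₀ hx]
  have h0 : 0 ≤ |f x| * (1 + x ^ 2) := by positivity
  calc f x ^ 2 * (1 + x ^ 2) ≤ f x ^ 2 * ((1 + x ^ 2) * (1 + x ^ 2)) := by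
        refine mul_le_mul_of_nonneg_left ?_ (sq_nonneg _)
        nlinarith
    _ = (|f x| * (1 + x ^ 2)) ^ 2 := by rw [mul_pow, sq_abs]; ring
    _ ≤ c ^ 2 := pow_le_pow_left₀ h0 (hc x) 2

lemma tendsto_atBot_zero_of_decay {f : ℝ → ℝ} {c : ℝ}
    (hc : ∀ x, |f x| * (1 + x ^ 2) ≤ c) : Tendsto f atBot (𝓝 0) := by
  have ht : Tendsto (fun x : ℝ => c * (1 + x ^ 2)⁻¹) atBot (𝓝 0) := by
    have h1 : Tendsto (fun x : ℝ => 1 + x ^ 2) atBot atTop := by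
      refine tendsto_atTop_add_const_left _ _ ?_
      simpa [Function.comp_def] using
        (tendsto_pow_atTop (α := ℝ) two_ne_zero).comp tendsto_abs_atBot_atTop
    simpa using h1.inv_tendsto_atTop.const_mul c
  refine squeeze_zero_norm (fun x => ?_) ht
  rw [Real.norm_eq_abs, ← div_eq_mul_inv, le_div_iff₀ (by positivity)]
  exact hc x

namespace DecayingMKdV

variable {u p q r z : ℝ → ℝ → ℝ}

lemma integrable_u (h : DecayingMKdV u p q r z) (t : ℝ) : Integrable fun x => u t x ^ 2 := by
  obtain ⟨c, hc⟩ := h.decu t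
  have := h.cu
  exact integrable_sq_of_decay (by fun_prop) hc

lemma integrable_p (h : DecayingMKdV u p q r z) (t : ℝ) : Integrable fun x => p t x ^ 2 := by
  obtain ⟨c, hc⟩ := h.decp t
  have := h.cp
  exact integrable_sq_of_decay (by fun_prop) hc

lemma integrable_q (h : DecayingMKdV u p q r z) (t : ℝ) : Integrable fun x => q t x ^ 2 := by
  obtain ⟨c, hc⟩ := h.decq t
  have := h.cq
  exact integrable_sq_of_decay (by fun_prop) hc

lemma integrable_density (h : DecayingMKdV u p q r z) (t : ℝ) :
    Integrable (sobolevDensity u p q t) :=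
  ((h.integrable_u t).add (h.integrable_p t)).add (h.integrable_q t)

lemma continuous_density (h : DecayingMKdV u p q r z) :
    Continuous (Function.uncurry (sobolevDensity u p q)) := by
  have := h.cu
  have := h.cp
  have := h.cq
  unfold sobolevDensity
  fun_prop

lemma integral_density (h : DecayingMKdV u p q r z) (t : ℝ) :
    ∫ x, sobolevDensity u p q t x
      = (∫ x, u t x ^ 2) + (∫ x, p t x ^ 2) + ∫ x, q t x ^ 2 := by
  rw [← integral_add (h.integrable_u t) (h.integrable_p t),
    ← integral_add (f := fun x => u t x ^ 2 + p t x ^ 2)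
      ((h.integrable_u t).add (h.integrable_p t)) (h.integrable_q t)]
  rfl

lemma u_sq_le (h : DecayingMKdV u p q r z) (t x : ℝ) {ε : ℝ} (hε : 0 < ε) :
    u t x ^ 2 ≤ ε * (∫ y, p t y ^ 2) + ε⁻¹ * ∫ y, u t y ^ 2 := by
  obtain ⟨c, hc⟩ := h.decu t
  have := h.cp
  exact sq_le_integral_add_integral (h.xu t) (by fun_prop) (tendsto_atBot_zero_of_decay hc)
    (h.integrable_u t) (h.integrable_p t) hε x

lemma u_sq_le_density (h : DecayingMKdV u p q r z) (t x : ℝ) :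
    u t x ^ 2 ≤ ∫ y, sobolevDensity u p q t y := by
  have h1 := h.u_sq_le t x one_pos
  have h2 : 0 ≤ ∫ y, q t y ^ 2 := integral_nonneg fun y => sq_nonneg _
  rw [h.integral_density]
  linarith

lemma p_sq_le_density (h : DecayingMKdV u p q r z) (t x : ℝ) :
    p t x ^ 2 ≤ ∫ y, sobolevDensity u p q t y := by
  obtain ⟨c, hc⟩ := h.decp t
  have := h.cq
  have h1 := sq_le_integral_add_integral (h.xp t) (by fun_prop) (tendsto_atBot_zero_of_decay hc)
    (h.integrable_p t) (h.integrable_q t) one_pos x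
  have h2 : 0 ≤ ∫ y, u t y ^ 2 := integral_nonneg fun y => sq_nonneg _
  rw [h.integral_density]
  linarith

variable {I : Set ℝ} {K : ℝ}

lemma bounded_u (h : DecayingMKdV u p q r z)
    (hK : ∀ τ ∈ I, ∫ x, sobolevDensity u p q τ x ≤ K) : DominatedOn I u fun _ _ => 1 := by
  refine ⟨√K, Real.sqrt_nonneg _, fun τ hτ x => ?_⟩
  rw [mul_one]
  exact Real.abs_le_sqrt ((h.u_sq_le_density τ x).trans (hK τ hτ))

lemma bounded_p (h : DecayingMKdV u p q r z)
    (hK : ∀ τ ∈ I, ∫ x, sobolevDensity u p q τ x ≤ K) : DominatedOn I p fun _ _ => 1 := by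
  refine ⟨√K, Real.sqrt_nonneg _, fun τ hτ x => ?_⟩
  rw [mul_one]
  exact Real.abs_le_sqrt ((h.p_sq_le_density τ x).trans (hK τ hτ))

lemma u_le (t x : ℝ) : u t x ^ 2 ≤ 2 * sobolevDensity u p q t x := by
  unfold sobolevDensity
  nlinarith [sq_nonneg (u t x), sq_nonneg (p t x), sq_nonneg (q t x)]

lemma p_le (t x : ℝ) : p t x ^ 2 ≤ 2 * sobolevDensity u p q t x := by
  unfold sobolevDensity
  nlinarith [sq_nonneg (u t x), sq_nonneg (p t x), sq_nonneg (q t x)]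

lemma q_le (t x : ℝ) : q t x ^ 2 ≤ 2 * sobolevDensity u p q t x := by
  unfold sobolevDensity
  nlinarith [sq_nonneg (u t x), sq_nonneg (p t x), sq_nonneg (q t x)]

lemma dominated_uu (_ : DecayingMKdV u p q r z) :
    DominatedOn I (fun τ x => u τ x * u τ x) (sobolevDensity u p q) :=
  .mul_of_sq_le u_le u_le

lemma dominated_uq (_ : DecayingMKdV u p q r z) :
    DominatedOn I (fun τ x => u τ x * q τ x) (sobolevDensity u p q) :=
  .mul_of_sq_le u_le q_le

lemma dominated_pp (_ : DecayingMKdV u p q r z) :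
    DominatedOn I (fun τ x => p τ x * p τ x) (sobolevDensity u p q) :=
  .mul_of_sq_le p_le p_le

lemma dominated_pq (_ : DecayingMKdV u p q r z) :
    DominatedOn I (fun τ x => p τ x * q τ x) (sobolevDensity u p q) :=
  .mul_of_sq_le p_le q_le

lemma dominated_qq (_ : DecayingMKdV u p q r z) :
    DominatedOn I (fun τ x => q τ x * q τ x) (sobolevDensity u p q) :=
  .mul_of_sq_le q_le q_le

lemma dominated_energyDensity (h : DecayingMKdV u p q r z)
    (hK : ∀ τ ∈ I, ∫ x, sobolevDensity u p q τ x ≤ K) :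
    DominatedOn I (fun t x => 1 / 2 * p t x ^ 2 - 1 / 4 * u t x ^ 4) (sobolevDensity u p q) := by
  have bu := h.bounded_u hK
  exact ((h.dominated_pp.const_mul (1 / 2)).sub
    ((h.dominated_uu.mul_bounded (bu.mul_bounded bu)).const_mul (1 / 4))).congr
    fun τ x => by ring

lemma dominated_correctionDensity (h : DecayingMKdV u p q r z)
    (hK : ∀ τ ∈ I, ∫ x, sobolevDensity u p q τ x ≤ K) :
    DominatedOn I (fun t x => -(5 / 2) * (u t x ^ 2 * p t x ^ 2) + 1 / 4 * u t x ^ 6)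
      (sobolevDensity u p q) := by
  have bu := h.bounded_u hK
  have buu := bu.mul_bounded bu
  exact (((h.dominated_pp.mul_bounded buu).const_mul (-(5 / 2))).add
    ((h.dominated_uu.mul_bounded (buu.mul_bounded buu)).const_mul (1 / 4))).congr
    fun τ x => by ring

lemma integrable_energyDensity (h : DecayingMKdV u p q r z) (t : ℝ) :
    Integrable fun x => 1 / 2 * p t x ^ 2 - 1 / 4 * u t x ^ 4 := by
  have := h.cu
  have := h.cp
  refine (h.dominated_energyDensity (I := {t}) (K := ∫ x, sobolevDensity u p q t x) ?_).integrable
    (by fun_prop) rfl (h.integrable_density t)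
  rintro τ rfl
  exact le_rfl

lemma integrable_correctionDensity (h : DecayingMKdV u p q r z) (t : ℝ) :
    Integrable fun x => -(5 / 2) * (u t x ^ 2 * p t x ^ 2) + 1 / 4 * u t x ^ 6 := by
  have := h.cu
  have := h.cp
  refine (h.dominated_correctionDensity (I := {t})
    (K := ∫ x, sobolevDensity u p q t x) ?_).integrable
    (by fun_prop) rfl (h.integrable_density t)
  rintro τ rfl
  exact le_rfl

lemma dominated_zero : DominatedOn I (fun _ _ => 0) (sobolevDensity u p q) :=
  .zero (sobolevDensity_nonneg u p q)

lemma integral_u_sq_eq (h : DecayingMKdV u p q r z)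
    (hK : ∀ τ ∈ I, ∫ x, sobolevDensity u p q τ x ≤ K) {s t : ℝ} (hI : Set.uIcc s t ⊆ I) :
    ∫ x, u t x ^ 2 = ∫ x, u s x ^ 2 := by
  have hK' := fun τ hτ => hK τ (hI hτ)
  have bu := h.bounded_u hK'
  have ha := ((h.dominated_uq.const_mul (-1)).add (h.dominated_pp.const_mul (1 / 2))).sub
    ((h.dominated_uu.mul_bounded (bu.mul_bounded bu)).const_mul (3 / 4))
  have key := h.massLaw.integral_sub_eq_one_of_dominated (sobolevDensity_nonneg u p q)
    h.integrable_density hK' dominated_zero (ha.congr fun τ x => by ring) dominated_zero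
    dominated_zero (fun τ => (h.integrable_u τ).const_mul _)
  simp only [integral_const_mul, integral_zero, intervalIntegral.integral_zero] at key
  linarith

lemma dominated_energyFlux (h : DecayingMKdV u p q r z)
    (hK : ∀ τ ∈ I, ∫ x, sobolevDensity u p q τ x ≤ K) :
    DominatedOn I
      (fun t x => q t x ^ 2 - 3 * u t x ^ 2 * p t x ^ 2 + 1 / 2 * (q t x + u t x ^ 3) ^ 2)
      (sobolevDensity u p q) := by
  have bu := h.bounded_u hK
  have buu := bu.mul_bounded bu
  exact ((((h.dominated_qq.const_mul (3 / 2)).sub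
    ((h.dominated_pp.mul_bounded buu).const_mul 3)).add
    (h.dominated_uq.mul_bounded buu)).add
    ((h.dominated_uu.mul_bounded (buu.mul_bounded buu)).const_mul (1 / 2))).congr
    fun τ x => by ring

lemma dominated_half_p_sq (h : DecayingMKdV u p q r z) :
    DominatedOn I (fun t x => -(1 / 2 * p t x ^ 2)) (sobolevDensity u p q) :=
  (h.dominated_pp.const_mul (-(1 / 2))).congr fun τ x => by ring

lemma energy_sub (h : DecayingMKdV u p q r z)
    (hK : ∀ τ ∈ I, ∫ x, sobolevDensity u p q τ x ≤ K) {s t : ℝ} (hI : Set.uIcc s t ⊆ I)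
    {φ₀ φ₁ φ₂ φ₃ : ℝ → ℝ} {M : ℝ} (w : BoundedWeight φ₀ φ₁ φ₂ φ₃ M) :
    (∫ x, (1 / 2 * p t x ^ 2 - 1 / 4 * u t x ^ 4) * φ₀ x)
      - ∫ x, (1 / 2 * p s x ^ 2 - 1 / 4 * u s x ^ 4) * φ₀ x
      = ∫ τ in s..t, ∫ x, (1 / 2 * p τ x ^ 2 * φ₃ x
        - (q τ x ^ 2 - 3 * u τ x ^ 2 * p τ x ^ 2 + 1 / 2 * (q τ x + u τ x ^ 3) ^ 2) * φ₁ x) := by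
  have hK' := fun τ hτ => hK τ (hI hτ)
  rw [h.energyLaw.integral_sub_eq_of_dominated w (sobolevDensity_nonneg u p q)
    h.integrable_density hK' dominated_zero (h.dominated_energyFlux hK') dominated_zero
    h.dominated_half_p_sq h.integrable_energyDensity]
  refine intervalIntegral.integral_congr fun τ _ => integral_congr_ae (ae_of_all _ fun x => ?_)
  ring

lemma energy_eq (h : DecayingMKdV u p q r z)
    (hK : ∀ τ ∈ I, ∫ x, sobolevDensity u p q τ x ≤ K) {s t : ℝ} (hI : Set.uIcc s t ⊆ I) :
    ∫ x, (1 / 2 * p t x ^ 2 - 1 / 4 * u t x ^ 4)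
      = ∫ x, (1 / 2 * p s x ^ 2 - 1 / 4 * u s x ^ 4) := by
  have hK' := fun τ hτ => hK τ (hI hτ)
  have key := h.energyLaw.integral_sub_eq_one_of_dominated (sobolevDensity_nonneg u p q)
    h.integrable_density hK' dominated_zero (h.dominated_energyFlux hK') dominated_zero
    h.dominated_half_p_sq h.integrable_energyDensity
  simp only [integral_zero, intervalIntegral.integral_zero] at key
  linarith

lemma gradient_sub (h : DecayingMKdV u p q r z)
    (hK : ∀ τ ∈ I, ∫ x, sobolevDensity u p q τ x ≤ K) :
    ∃ c, ∀ s t, Set.uIcc s t ⊆ I →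
      |(∫ x, p t x ^ 2) - ∫ x, p s x ^ 2| ≤ c * |t - s| := by
  have bu := h.bounded_u hK
  have hS := ((h.dominated_pp.mul_bounded (bu.mul_bounded (h.bounded_p hK))).const_mul 6).add
    ((h.dominated_pq.mul_bounded (bu.mul_bounded bu)).const_mul 3) |>.const_mul (-1)
  have hS' : DominatedOn I (fun t x => -(6 * (u t x * p t x * (p t x * p t x))
      + 3 * (u t x * u t x * (p t x * q t x)))) (sobolevDensity u p q) :=
    hS.congr fun τ x => by ring
  obtain ⟨c, hc⟩ := hS'.exists_abs_integral_le h.integrable_density hK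
  refine ⟨2 * c, fun s t hI => ?_⟩
  have key := h.gradientLaw.integral_sub_eq_one_of_dominated (s := s) (t := t)
    (sobolevDensity_nonneg u p q) h.integrable_density (fun τ hτ => hK τ (hI hτ))
    (hS'.mono_set hI)
    ((h.dominated_qq.const_mul (3 / 2)).congr fun τ x => by ring) dominated_zero
    h.dominated_half_p_sq (fun τ => (h.integrable_p τ).const_mul _)
  simp only [integral_const_mul] at key
  have hle : ‖∫ τ in s..t, ∫ x, -(6 * (u τ x * p τ x * (p τ x * p τ x))
      + 3 * (u τ x * u τ x * (p τ x * q τ x)))‖ ≤ c * |t - s| :=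
    intervalIntegral.norm_integral_le_of_norm_le_const
      fun τ hτ => hc τ (hI (Set.uIoc_subset_uIcc hτ))
  rw [← key, Real.norm_eq_abs, ← mul_sub, abs_mul, abs_of_pos one_half_pos] at hle
  linarith

lemma dominated_correctionSource (h : DecayingMKdV u p q r z)
    (hK : ∀ τ ∈ I, ∫ x, sobolevDensity u p q τ x ≤ K) :
    DominatedOn I (fun t x => 15 * (u t x * p t x * (q t x * q t x))) (sobolevDensity u p q) :=
  (h.dominated_qq.mul_bounded ((h.bounded_p hK).mul_bounded (h.bounded_u hK))).const_mul 15

lemma correction_sub (h : DecayingMKdV u p q r z)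
    (hK : ∀ τ ∈ I, ∫ x, sobolevDensity u p q τ x ≤ K) {s t : ℝ} (hI : Set.uIcc s t ⊆ I) :
    (∫ x, (-(5 / 2) * (u t x ^ 2 * p t x ^ 2) + 1 / 4 * u t x ^ 6))
      - ∫ x, (-(5 / 2) * (u s x ^ 2 * p s x ^ 2) + 1 / 4 * u s x ^ 6)
      = ∫ τ in s..t, ∫ x, 15 * (u τ x * p τ x * (q τ x * q τ x)) := by
  have hK' := fun τ hτ => hK τ (hI hτ)
  have bu := h.bounded_u hK'
  have bp := h.bounded_p hK'
  have buu := bu.mul_bounded bu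
  have bup := bu.mul_bounded bp
  have buuuu := buu.mul_bounded buu
  have hb := (h.dominated_pq.mul_bounded buu).const_mul 5
  have h1 := (h.dominated_pp.mul_bounded buuuu).const_mul (45 / 4)
  have h2 := (h.dominated_pq.mul_bounded bup).const_mul (15)
  have h3 := (h.dominated_pp.mul_bounded (bp.mul_bounded bp)).const_mul (5 / 4)
  have h4 := (h.dominated_qq.mul_bounded buu).const_mul (15 / 2)
  have h5 := (h.dominated_uq.mul_bounded buuuu).const_mul (3 / 2)
  have h6 := (h.dominated_uu.mul_bounded (buuuu.mul_bounded buu)).const_mul (9 / 16)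
  exact h.correctionLaw.integral_sub_eq_one_of_dominated (sobolevDensity_nonneg u p q)
    h.integrable_density hK' (h.dominated_correctionSource hK')
    ((((((h1.sub h2).add h3).sub h4).sub h5).sub h6).congr fun τ x => by ring)
    (hb.congr fun τ x => by ring) dominated_zero h.integrable_correctionDensity

end DecayingMKdV

lemma DominatedOn.comp_add_right {I : Set ℝ} {J : ℝ → ℝ → ℝ}
    (h : DominatedOn I J fun _ _ => 1) (k : ℝ) :
    DominatedOn I (fun τ x => J τ (x + k)) fun _ _ => 1 := by
  obtain ⟨c, hc, h⟩ := h
  exact ⟨c, hc, fun τ hτ x => h τ hτ (x + k)⟩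

/-- The source term of the balance law for the squared difference quotient of `p`. -/
noncomputable def quotientSource (u p q : ℝ → ℝ → ℝ) (k t x : ℝ) : ℝ :=
  -(3 / 2 * (2 * u t (x + k) * p t (x + k) + p t (x + k) * u t x
        + u t (x + k) * p t x + 2 * u t x * p t x) * (k⁻¹ * (p t (x + k) - p t x)) ^ 2
    + (2 * p t (x + k) ^ 2 + 2 * u t (x + k) * q t (x + k) + q t (x + k) * u t x
        + 2 * p t (x + k) * p t x + u t (x + k) * q t x + 2 * p t x ^ 2 + 2 * u t x * q t x)
      * (k⁻¹ * (u t (x + k) - u t x)) * (k⁻¹ * (p t (x + k) - p t x)))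

lemma abs_quotient_le_of_hasDerivAt {f f' : ℝ → ℝ} (hf : ∀ x, HasDerivAt f (f' x) x) {c k x : ℝ}
    (hk : 0 < k) (hc : ∀ y, x ≤ y → y ≤ x + k → |f' y| ≤ c) :
    |k⁻¹ * (f (x + k) - f x)| ≤ c := by
  obtain ⟨y, hy, e⟩ := exists_hasDerivAt_eq_slope f f' (show x < x + k by linarith)
    (fun y _ => (hf y).continuousAt.continuousWithinAt) fun y _ => hf y
  rw [add_sub_cancel_left, div_eq_inv_mul] at e
  rw [← e]
  exact hc y hy.1.le hy.2.le

lemma abs_quotient_le_of_decay {f f' : ℝ → ℝ} (hf : ∀ x, HasDerivAt f (f' x) x) {c : ℝ}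
    (hc : ∀ y, |f' y| * (1 + y ^ 2) ≤ c) {k : ℝ} (hk : 0 < k) (hk1 : k ≤ 1) (x : ℝ) :
    |k⁻¹ * (f (x + k) - f x)| ≤ 3 * c * (1 + x ^ 2)⁻¹ := by
  refine abs_quotient_le_of_hasDerivAt hf hk fun y hy hy' => ?_
  rw [← div_eq_mul_inv, le_div_iff₀ (by positivity)]
  have h1 : 1 + x ^ 2 ≤ 3 * (1 + y ^ 2) := by
    nlinarith [sq_nonneg (y + (y - x)), mul_nonneg (sub_nonneg.2 hy) (sub_nonneg.2 (hy'.trans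
      (add_le_add_right hk1 x)))]
  calc |f' y| * (1 + x ^ 2) ≤ |f' y| * (3 * (1 + y ^ 2)) :=
        mul_le_mul_of_nonneg_left h1 (abs_nonneg _)
    _ ≤ 3 * c := by linarith [hc y]

namespace DecayingMKdV

variable {u p q r z : ℝ → ℝ → ℝ} {I : Set ℝ} {K : ℝ}

lemma continuous_quotientSource (h : DecayingMKdV u p q r z) (k : ℝ) :
    Continuous (Function.uncurry (quotientSource u p q k)) := by
  have := h.cu
  have := h.cp
  have := h.cq
  unfold quotientSource
  fun_prop

lemma differenceSource_eq (k : ℝ) (hk : k ≠ 0) (t x : ℝ) :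
    -(3 / 2 * (2 * u t (x + k) * p t (x + k) + p t (x + k) * u t x
            + u t (x + k) * p t x + 2 * u t x * p t x) * (p t (x + k) - p t x) ^ 2
        + (2 * p t (x + k) ^ 2 + 2 * u t (x + k) * q t (x + k) + q t (x + k) * u t x
            + 2 * p t (x + k) * p t x + u t (x + k) * q t x + 2 * p t x ^ 2 + 2 * u t x * q t x)
          * (u t (x + k) - u t x) * (p t (x + k) - p t x))
      = k ^ 2 * quotientSource u p q k t x := by
  unfold quotientSource
  field_simp

/-- The sum of the density and its translate. -/
noncomputable def pairDensity (u p q : ℝ → ℝ → ℝ) (k t x : ℝ) : ℝ :=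
  sobolevDensity u p q t x + sobolevDensity u p q t (x + k)

lemma pairDensity_nonneg (k t x : ℝ) : 0 ≤ pairDensity u p q k t x :=
  add_nonneg (sobolevDensity_nonneg _ _ _ _ _) (sobolevDensity_nonneg _ _ _ _ _)

lemma integrable_pairDensity (h : DecayingMKdV u p q r z) (k t : ℝ) :
    Integrable (pairDensity u p q k t) :=
  (h.integrable_density t).add ((h.integrable_density t).comp_add_right k)

lemma integral_pairDensity (h : DecayingMKdV u p q r z) (k t : ℝ) :
    ∫ x, pairDensity u p q k t x = 2 * ∫ x, sobolevDensity u p q t x := by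
  have e := integral_add_right_eq_self (μ := volume) (sobolevDensity u p q t) k
  simp only [pairDensity]
  rw [integral_add (h.integrable_density t) ((h.integrable_density t).comp_add_right k), e]
  ring

lemma pairDensity_eq {k t x : ℝ} : pairDensity u p q k t x
    = u t x ^ 2 + p t x ^ 2 + q t x ^ 2
      + (u t (x + k) ^ 2 + p t (x + k) ^ 2 + q t (x + k) ^ 2) := rfl

lemma q_sq_le_pairDensity {k : ℝ} (t x : ℝ) : q t x ^ 2 ≤ 2 * pairDensity u p q k t x := by
  rw [pairDensity_eq]
  nlinarith [sq_nonneg (u t x), sq_nonneg (p t x), sq_nonneg (q t x), sq_nonneg (u t (x + k)),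
    sq_nonneg (p t (x + k)), sq_nonneg (q t (x + k))]

lemma q_translate_sq_le {k : ℝ} (t x : ℝ) :
    q t (x + k) ^ 2 ≤ 2 * pairDensity u p q k t x := by
  rw [pairDensity_eq]
  nlinarith [sq_nonneg (u t x), sq_nonneg (p t x), sq_nonneg (q t x), sq_nonneg (u t (x + k)),
    sq_nonneg (p t (x + k)), sq_nonneg (q t (x + k))]

lemma u_sub_sq_le {k : ℝ} (t x : ℝ) :
    (u t (x + k) - u t x) ^ 2 ≤ 2 * pairDensity u p q k t x := by
  rw [pairDensity_eq]
  nlinarith [sq_nonneg (u t x + u t (x + k)), sq_nonneg (p t x), sq_nonneg (q t x),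
    sq_nonneg (p t (x + k)), sq_nonneg (q t (x + k))]

lemma p_sub_sq_le {k : ℝ} (t x : ℝ) :
    (p t (x + k) - p t x) ^ 2 ≤ 2 * pairDensity u p q k t x := by
  rw [pairDensity_eq]
  nlinarith [sq_nonneg (p t x + p t (x + k)), sq_nonneg (u t x), sq_nonneg (q t x),
    sq_nonneg (u t (x + k)), sq_nonneg (q t (x + k))]

lemma q_sub_sq_le {k : ℝ} (t x : ℝ) :
    (q t (x + k) - q t x) ^ 2 ≤ 2 * pairDensity u p q k t x := by
  rw [pairDensity_eq]
  nlinarith [sq_nonneg (q t x + q t (x + k)), sq_nonneg (u t x), sq_nonneg (p t x),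
    sq_nonneg (u t (x + k)), sq_nonneg (p t (x + k))]

lemma dominated_quotientSource (h : DecayingMKdV u p q r z)
    (hK : ∀ τ ∈ I, ∫ x, sobolevDensity u p q τ x ≤ K) (k : ℝ) :
    DominatedOn I (quotientSource u p q k) (pairDensity u p q k) := by
  have bu := h.bounded_u hK
  have bp := h.bounded_p hK
  have bu' := bu.comp_add_right k
  have bp' := bp.comp_add_right k
  have bv := bu'.sub bu
  have d₁ : DominatedOn I (fun τ x => (p τ (x + k) - p τ x) * (p τ (x + k) - p τ x))
      (pairDensity u p q k) := .mul_of_sq_le p_sub_sq_le p_sub_sq_le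
  have d₂ : DominatedOn I (fun τ x => (u τ (x + k) - u τ x) * (p τ (x + k) - p τ x))
      (pairDensity u p q k) := .mul_of_sq_le u_sub_sq_le p_sub_sq_le
  have d₃ : DominatedOn I (fun τ x => q τ (x + k) * (p τ (x + k) - p τ x))
      (pairDensity u p q k) := .mul_of_sq_le q_translate_sq_le p_sub_sq_le
  have d₄ : DominatedOn I (fun τ x => q τ x * (p τ (x + k) - p τ x))
      (pairDensity u p q k) := .mul_of_sq_le q_sq_le_pairDensity p_sub_sq_le
  have e₁ := d₁.mul_bounded (((((bu'.mul_bounded bp').const_mul 2).add (bp'.mul_bounded bu)).add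
    (bu'.mul_bounded bp)).add ((bu.mul_bounded bp).const_mul 2))
  have e₂ := d₂.mul_bounded (((bp'.mul_bounded bp').add (bp'.mul_bounded bp)).add
    (bp.mul_bounded bp))
  have e₃ := d₃.mul_bounded (bv.mul_bounded ((bu'.const_mul 2).add bu))
  have e₄ := d₄.mul_bounded (bv.mul_bounded (bu'.add (bu.const_mul 2)))
  exact (((((e₁.const_mul (3 / 2)).add (e₂.const_mul 2)).add e₃).add e₄).const_mul
    (-(k⁻¹ ^ 2))).congr fun τ x => by unfold quotientSource; ring

lemma p_quotient_sub (h : DecayingMKdV u p q r z)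
    (hK : ∀ τ ∈ I, ∫ x, sobolevDensity u p q τ x ≤ K) {s t : ℝ} (hI : Set.uIcc s t ⊆ I) {k : ℝ}
    (hk : k ≠ 0) :
    (∫ x, 1 / 2 * (k⁻¹ * (p t (x + k) - p t x)) ^ 2)
      - ∫ x, 1 / 2 * (k⁻¹ * (p s (x + k) - p s x)) ^ 2
      = ∫ τ in s..t, ∫ x, quotientSource u p q k τ x := by
  have hK' := fun τ hτ => hK τ (hI hτ)
  have bu := h.bounded_u hK'
  have bu' := bu.comp_add_right k
  have d₁ : DominatedOn (Set.uIcc s t) (fun τ x => (p τ (x + k) - p τ x) * (p τ (x + k) - p τ x))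
      (pairDensity u p q k) := .mul_of_sq_le p_sub_sq_le p_sub_sq_le
  have d₂ : DominatedOn (Set.uIcc s t) (fun τ x => (q τ (x + k) - q τ x) * (q τ (x + k) - q τ x))
      (pairDensity u p q k) := .mul_of_sq_le q_sub_sq_le q_sub_sq_le
  have d₄ := d₁.mul_bounded (((bu'.mul_bounded bu').add (bu'.mul_bounded bu)).add
    (bu.mul_bounded bu))
  have key := (h.differenceLaw k).integral_sub_eq_one_of_dominated (s := s) (t := t)
    (K := 2 * K) (pairDensity_nonneg k) (h.integrable_pairDensity k)
    (fun τ hτ => by rw [h.integral_pairDensity]; linarith [hK' τ hτ])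
    (((h.dominated_quotientSource hK' k).const_mul (k ^ 2)).congr fun τ x =>
      (differenceSource_eq k hk τ x).symm)
    (((d₂.const_mul (3 / 2)).sub (d₄.const_mul (1 / 2))).congr fun τ x => by ring)
    (.zero (pairDensity_nonneg k)) ((d₁.const_mul (-(1 / 2))).congr fun τ x => by ring)
    ?_
  · simp only [differenceSource_eq k hk, integral_const_mul, intervalIntegral.integral_const_mul,
      mul_pow] at key ⊢
    have hk2 : k⁻¹ ^ 2 * k ^ 2 = 1 := by field_simp
    linear_combination k⁻¹ ^ 2 * key
      + (∫ τ in s..t, ∫ x, quotientSource u p q k τ x) * hk2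
  · intro τ
    have := h.cp
    have d : DominatedOn Set.univ (fun τ x => (p τ (x + k) - p τ x) * (p τ (x + k) - p τ x))
      (pairDensity u p q k) := .mul_of_sq_le p_sub_sq_le p_sub_sq_le
    exact ((d.const_mul (1 / 2)).congr (J' := fun t x => 1 / 2 * (p t (x + k) - p t x) ^ 2)
      fun τ x => by ring).integrable (by fun_prop) (Set.mem_univ τ) (h.integrable_pairDensity k τ)

end DecayingMKdV

lemma abs_mul_mul_mul_le {x y m n L : ℝ} (hx : |x| ≤ L) (hy : |y| ≤ L) :
    |x * y * (m * n)| ≤ L ^ 2 * ((m ^ 2 + n ^ 2) / 2) := by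
  have h1 : |x * y| ≤ L ^ 2 := by
    rw [abs_mul, sq]
    exact mul_le_mul hx hy (abs_nonneg _) ((abs_nonneg _).trans hx)
  have h2 : |m * n| ≤ (m ^ 2 + n ^ 2) / 2 := by
    rw [abs_le]
    constructor <;> nlinarith [sq_nonneg (m + n), sq_nonneg (m - n)]
  rw [abs_mul]
  exact mul_le_mul h1 h2 (abs_nonneg _) (sq_nonneg _)

lemma abs_quotientSource_le_aux {a b c d e f V W L : ℝ} (ha : |a| ≤ L) (hb : |b| ≤ L) (hc : |c| ≤ L)
    (hd : |d| ≤ L) (hV : |V| ≤ L) :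
    |-(3 / 2 * (2 * a * c + c * b + a * d + 2 * b * d) * W ^ 2
      + (2 * c ^ 2 + 2 * a * e + e * b + 2 * c * d + a * f + 2 * d ^ 2 + 2 * b * f) * V * W)|
      ≤ L ^ 2 * (15 * W ^ 2 + 2 * (c ^ 2 + d ^ 2 + e ^ 2 + f ^ 2)) := by
  have a₁ := abs_le.1 (abs_mul_mul_mul_le (m := W) (n := W) ha hc)
  have a₂ := abs_le.1 (abs_mul_mul_mul_le (m := W) (n := W) hc hb)
  have a₃ := abs_le.1 (abs_mul_mul_mul_le (m := W) (n := W) ha hd)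
  have a₄ := abs_le.1 (abs_mul_mul_mul_le (m := W) (n := W) hb hd)
  have b₁ := abs_le.1 (abs_mul_mul_mul_le (m := c) (n := W) hc hV)
  have b₂ := abs_le.1 (abs_mul_mul_mul_le (m := e) (n := W) ha hV)
  have b₃ := abs_le.1 (abs_mul_mul_mul_le (m := e) (n := W) hb hV)
  have b₄ := abs_le.1 (abs_mul_mul_mul_le (m := c) (n := W) hd hV)
  have b₅ := abs_le.1 (abs_mul_mul_mul_le (m := f) (n := W) ha hV)
  have b₆ := abs_le.1 (abs_mul_mul_mul_le (m := d) (n := W) hd hV)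
  have b₇ := abs_le.1 (abs_mul_mul_mul_le (m := f) (n := W) hb hV)
  have c₀ : 0 ≤ L ^ 2 * c ^ 2 := by positivity
  have d₀ : 0 ≤ L ^ 2 * d ^ 2 := by positivity
  have e₀ : 0 ≤ L ^ 2 * e ^ 2 := by positivity
  have f₀ : 0 ≤ L ^ 2 * f ^ 2 := by positivity
  rw [abs_le]
  constructor
  · linarith [a₁.2, a₂.2, a₃.2, a₄.2, b₁.2, b₂.2, b₃.2, b₄.2, b₅.2, b₆.2, b₇.2]
  · linarith [a₁.1, a₂.1, a₃.1, a₄.1, b₁.1, b₂.1, b₃.1, b₄.1, b₅.1, b₆.1, b₇.1]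

lemma abs_quotientSource_le_of_bound {a b c d e f V W L : ℝ} (ha : |a| ≤ L) (hb : |b| ≤ L)
    (hc : |c| ≤ L) (hd : |d| ≤ L) (he : |e| ≤ L) (hf : |f| ≤ L) (hV : |V| ≤ L) (hW : |W| ≤ L) :
    |-(3 / 2 * (2 * a * c + c * b + a * d + 2 * b * d) * W ^ 2
      + (2 * c ^ 2 + 2 * a * e + e * b + 2 * c * d + a * f + 2 * d ^ 2 + 2 * b * f) * V * W)|
      ≤ 21 * L ^ 3 * |W| := by
  have key : ∀ {x y m : ℝ}, |x| ≤ L → |y| ≤ L → |m| ≤ L → |x * y * m * W| ≤ L ^ 3 * |W| := by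
    intro x y m hx hy hm
    have L0 : 0 ≤ L := (abs_nonneg _).trans hx
    rw [abs_mul, abs_mul, abs_mul]
    refine mul_le_mul_of_nonneg_right ?_ (abs_nonneg _)
    calc |x| * |y| * |m| ≤ L * L * L := by gcongr
      _ = L ^ 3 := by ring
  have a₁ := abs_le.1 (key ha hc hW)
  have a₂ := abs_le.1 (key hc hb hW)
  have a₃ := abs_le.1 (key ha hd hW)
  have a₄ := abs_le.1 (key hb hd hW)
  have b₁ := abs_le.1 (key hc hc hV)
  have b₂ := abs_le.1 (key ha he hV)
  have b₃ := abs_le.1 (key hb he hV)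
  have b₄ := abs_le.1 (key hc hd hV)
  have b₅ := abs_le.1 (key ha hf hV)
  have b₆ := abs_le.1 (key hd hd hV)
  have b₇ := abs_le.1 (key hb hf hV)
  rw [abs_le]
  constructor
  · linarith [a₁.2, a₂.2, a₃.2, a₄.2, b₁.2, b₂.2, b₃.2, b₄.2, b₅.2, b₆.2, b₇.2]
  · linarith [a₁.1, a₂.1, a₃.1, a₄.1, b₁.1, b₂.1, b₃.1, b₄.1, b₅.1, b₆.1, b₇.1]

namespace DecayingMKdV

variable {u p q r z : ℝ → ℝ → ℝ} {I : Set ℝ} {K : ℝ}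

lemma exists_abs_integral_quotientSource_le (h : DecayingMKdV u p q r z)
    (hK : ∀ τ ∈ I, ∫ x, sobolevDensity u p q τ x ≤ K) :
    ∃ c, ∀ τ ∈ I, ∀ k, 0 < k → |∫ x, quotientSource u p q k τ x| ≤ c := by
  obtain ⟨L₁, h₁, hu⟩ := h.bounded_u hK
  obtain ⟨L₂, h₂, hp⟩ := h.bounded_p hK
  simp only [mul_one] at hu hp
  set L := L₁ + L₂ with hL
  refine ⟨L ^ 2 * (15 * K + 4 * K), fun τ hτ k hk => ?_⟩
  have hu' : ∀ x, |u τ x| ≤ L := fun x => (hu τ hτ x).trans (by linarith)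
  have hp' : ∀ x, |p τ x| ≤ L := fun x => (hp τ hτ x).trans (by linarith)
  have := h.cp
  have := h.cq
  have iw : Integrable fun x => (p τ (x + k) - p τ x) ^ 2 := by
    have d : DominatedOn Set.univ (fun τ x => (p τ (x + k) - p τ x) * (p τ (x + k) - p τ x))
      (pairDensity u p q k) := .mul_of_sq_le p_sub_sq_le p_sub_sq_le
    exact (d.congr fun τ x => (sq _).symm).integrable (by fun_prop)
      (Set.mem_univ τ) (h.integrable_pairDensity k τ)
  have iW : Integrable fun x => (k⁻¹ * (p τ (x + k) - p τ x)) ^ 2 := by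
    simpa only [mul_pow] using iw.const_mul (k⁻¹ ^ 2)
  have hw : ∫ x, (k⁻¹ * (p τ (x + k) - p τ x)) ^ 2 ≤ K := by
    have e := integral_sq_sub_translate_le (h.xp τ) (by fun_prop) (h.integrable_q τ) hk.le iw
    have : ∫ x, q τ x ^ 2 ≤ K := by
      have := hK τ hτ
      rw [h.integral_density] at this
      have h1 : 0 ≤ ∫ y, u τ y ^ 2 := integral_nonneg fun y => sq_nonneg _
      have h2 : 0 ≤ ∫ y, p τ y ^ 2 := integral_nonneg fun y => sq_nonneg _
      linarith
    simp only [mul_pow, integral_const_mul]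
    calc k⁻¹ ^ 2 * ∫ x, (p τ (x + k) - p τ x) ^ 2 ≤ k⁻¹ ^ 2 * (k ^ 2 * ∫ x, q τ x ^ 2) :=
          mul_le_mul_of_nonneg_left e (by positivity)
      _ = ∫ x, q τ x ^ 2 := by field_simp
      _ ≤ K := this
  have hle : ‖∫ x, quotientSource u p q k τ x‖
      ≤ ∫ x, L ^ 2 * (15 * (k⁻¹ * (p τ (x + k) - p τ x)) ^ 2 + 2 * pairDensity u p q k τ x) := by
    refine norm_integral_le_of_norm_le (((iW.const_mul 15).add
      ((h.integrable_pairDensity k τ).const_mul 2)).const_mul _) (ae_of_all _ fun x => ?_)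
    refine (abs_quotientSource_le_aux (hu' (x + k)) (hu' x) (hp' (x + k)) (hp' x)
      (abs_quotient_le_of_hasDerivAt (h.xu τ) hk fun y _ _ => hp' y)).trans ?_
    refine mul_le_mul_of_nonneg_left ?_ (sq_nonneg _)
    rw [pairDensity_eq]
    linarith [sq_nonneg (u τ x), sq_nonneg (u τ (x + k))]
  refine hle.trans ?_
  rw [integral_const_mul, integral_add (iW.const_mul 15)
    ((h.integrable_pairDensity k τ).const_mul 2), integral_const_mul, integral_const_mul,
    h.integral_pairDensity]
  refine mul_le_mul_of_nonneg_left ?_ (sq_nonneg _)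
  linarith [hK τ hτ]

lemma exists_bound (h : DecayingMKdV u p q r z) (t : ℝ) :
    ∃ L, (∀ x, |u t x| ≤ L) ∧ (∀ x, |p t x| ≤ L) ∧ (∀ x, |q t x| ≤ L) ∧
      ∀ k, 0 < k → k ≤ 1 → ∀ x, |k⁻¹ * (p t (x + k) - p t x)| ≤ 3 * L * (1 + x ^ 2)⁻¹ := by
  obtain ⟨c₁, h₁⟩ := h.decu t
  obtain ⟨c₂, h₂⟩ := h.decp t
  obtain ⟨c₃, h₃⟩ := h.decq t
  have le : ∀ {f : ℝ → ℝ} {c}, (∀ x, |f x| * (1 + x ^ 2) ≤ c) → ∀ x, |f x| ≤ c :=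
    fun hf x => (le_mul_of_one_le_right (abs_nonneg _) (by nlinarith)).trans (hf x)
  have p₁ : 0 ≤ c₁ := (abs_nonneg _).trans (le h₁ 0)
  have p₂ : 0 ≤ c₂ := (abs_nonneg _).trans (le h₂ 0)
  have p₃ : 0 ≤ c₃ := (abs_nonneg _).trans (le h₃ 0)
  exact ⟨c₁ + c₂ + c₃, fun x => (le h₁ x).trans (by linarith),
    fun x => (le h₂ x).trans (by linarith), fun x => (le h₃ x).trans (by linarith),
    fun k hk hk1 x => abs_quotient_le_of_decay (h.xp t) (fun y => (h₃ y).trans (by linarith)) hk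
      hk1 x⟩

lemma tendsto_quotient {f : ℝ → ℝ} {f' x : ℝ} (hf : HasDerivAt f f' x) :
    Tendsto (fun k => k⁻¹ * (f (x + k) - f x)) (𝓝[>] 0) (𝓝 f') := by
  simpa using hf.tendsto_slope_zero_right

lemma tendsto_translate {f : ℝ → ℝ} (hf : Continuous f) (x : ℝ) :
    Tendsto (fun k => f (x + k)) (𝓝[>] 0) (𝓝 (f x)) := by
  have : Continuous fun k => f (x + k) := by fun_prop
  simpa using (this.tendsto 0).mono_left nhdsWithin_le_nhds

lemma eventually_mem_Ioc : ∀ᶠ k : ℝ in 𝓝[>] 0, 0 < k ∧ k ≤ 1 := by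
  filter_upwards [self_mem_nhdsWithin, mem_nhdsWithin_of_mem_nhds (Iic_mem_nhds one_pos)]
    with k h h'
  exact ⟨h, h'⟩

lemma integral_p_pow_three_mul_q (h : DecayingMKdV u p q r z) (t : ℝ) :
    (Integrable fun x => p t x ^ 3 * q t x) ∧ ∫ x, p t x ^ 3 * q t x = 0 := by
  have := h.cp
  have := h.cq
  have hK : ∀ τ ∈ ({t} : Set ℝ), ∫ x, sobolevDensity u p q τ x
      ≤ ∫ x, sobolevDensity u p q t x := by
    rintro τ rfl
    exact le_rfl
  have bp := h.bounded_p hK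
  have i₁ : Integrable fun x => p t x ^ 3 * q t x :=
    ((h.dominated_pq.mul_bounded (bp.mul_bounded bp)).congr
      (J' := fun t x => p t x ^ 3 * q t x) fun τ x => by ring).integrable (by fun_prop)
      (Set.mem_singleton t) (h.integrable_density t)
  have i₂ : Integrable fun x => 1 / 4 * p t x ^ 4 :=
    (((h.dominated_pp.mul_bounded (bp.mul_bounded bp)).const_mul (1 / 4)).congr
      (J' := fun t x => 1 / 4 * p t x ^ 4) fun τ x => by ring).integrable (by fun_prop)
      (Set.mem_singleton t) (h.integrable_density t)
  refine ⟨i₁, integral_eq_zero_of_hasDerivAt_of_integrable (fun x => ?_) i₁ i₂⟩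
  refine (((h.xp t x).pow 4).const_mul (1 / 4)).congr_deriv ?_
  norm_num
  ring

lemma integrable_correctionSource (h : DecayingMKdV u p q r z) (t : ℝ) :
    Integrable fun x => 15 * (u t x * p t x * (q t x * q t x)) := by
  have := h.cu
  have := h.cp
  have := h.cq
  refine (h.dominated_correctionSource (I := {t})
    (K := ∫ x, sobolevDensity u p q t x) ?_).integrable
    (by fun_prop) rfl (h.integrable_density t)
  rintro τ rfl
  exact le_rfl

lemma tendsto_integral_quotientSource (h : DecayingMKdV u p q r z) (t : ℝ) :
    Tendsto (fun k => ∫ x, quotientSource u p q k t x) (𝓝[>] 0)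
      (𝓝 (-∫ x, 15 * (u t x * p t x * (q t x * q t x)))) := by
  obtain ⟨L, hu, hp, hq, hw⟩ := h.exists_bound t
  have cu := h.cu
  have cp := h.cp
  have cq := h.cq
  obtain ⟨i, e⟩ := h.integral_p_pow_three_mul_q t
  have elim : -∫ x, 15 * (u t x * p t x * (q t x * q t x))
      = ∫ x, (-(15 * (u t x * p t x * (q t x * q t x))) - 6 * (p t x ^ 3 * q t x)) := by
    rw [integral_sub (f := fun x => -(15 * (u t x * p t x * (q t x * q t x))))
      (h.integrable_correctionSource t).neg (i.const_mul 6), integral_neg,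
      integral_const_mul 6, e, mul_zero, sub_zero]
  rw [elim]
  have L0 : 0 ≤ L := (abs_nonneg _).trans (hu 0)
  refine tendsto_integral_filter_of_dominated_convergence
    (fun x => 21 * L ^ 3 * (3 * L * (1 + x ^ 2)⁻¹)) (Eventually.of_forall fun k => ?_) ?_
    ((integrable_inv_one_add_sq.const_mul _).const_mul _) (ae_of_all _ fun x => ?_)
  · have := h.continuous_quotientSource k
    exact Continuous.aestronglyMeasurable (by fun_prop)
  · filter_upwards [eventually_mem_Ioc] with k hk
    refine ae_of_all _ fun x => ?_
    exact (abs_quotientSource_le_of_bound (hu (x + k)) (hu x) (hp (x + k)) (hp x) (hq (x + k))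
      (hq x) (abs_quotient_le_of_hasDerivAt (h.xu t) hk.1 fun y _ _ => hp y)
      (abs_quotient_le_of_hasDerivAt (h.xp t) hk.1 fun y _ _ => hq y)).trans
      (mul_le_mul_of_nonneg_left (hw k hk.1 hk.2 x) (by positivity))
  · have U := tendsto_translate (f := u t) (by fun_prop) x
    have P := tendsto_translate (f := p t) (by fun_prop) x
    have Q := tendsto_translate (f := q t) (by fun_prop) x
    have V := tendsto_quotient (h.xu t x)
    have W := tendsto_quotient (h.xp t x)
    have hc : Continuous fun y : ℝ × ℝ × ℝ × ℝ × ℝ =>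
        -(3 / 2 * (2 * y.1 * y.2.1 + y.2.1 * u t x + y.1 * p t x + 2 * u t x * p t x)
            * y.2.2.2.2 ^ 2
          + (2 * y.2.1 ^ 2 + 2 * y.1 * y.2.2.1 + y.2.2.1 * u t x + 2 * y.2.1 * p t x
            + y.1 * q t x + 2 * p t x ^ 2 + 2 * u t x * q t x) * y.2.2.2.1 * y.2.2.2.2) := by
      fun_prop
    convert (hc.tendsto (u t x, p t x, q t x, p t x, q t x)).comp
      (U.prodMk_nhds (P.prodMk_nhds (Q.prodMk_nhds (V.prodMk_nhds W)))) using 2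
    · rfl
    · dsimp only
      ring

lemma tendsto_integral_quotient_sq (h : DecayingMKdV u p q r z) (t : ℝ) :
    Tendsto (fun k => ∫ x, 1 / 2 * (k⁻¹ * (p t (x + k) - p t x)) ^ 2) (𝓝[>] 0)
      (𝓝 (∫ x, 1 / 2 * q t x ^ 2)) := by
  obtain ⟨L, -, -, hq, hw⟩ := h.exists_bound t
  have cp := h.cp
  have L0 : 0 ≤ L := (abs_nonneg _).trans (hq 0)
  refine tendsto_integral_filter_of_dominated_convergence
    (fun x => L * (3 * L * (1 + x ^ 2)⁻¹)) (Eventually.of_forall fun k => ?_) ?_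
    ((integrable_inv_one_add_sq.const_mul _).const_mul _)
    (ae_of_all _ fun x => ((tendsto_quotient (h.xp t x)).pow 2).const_mul _)
  · exact Continuous.aestronglyMeasurable (by fun_prop)
  · filter_upwards [eventually_mem_Ioc] with k hk
    refine ae_of_all _ fun x => ?_
    have h₁ := abs_quotient_le_of_hasDerivAt (x := x) (h.xp t) hk.1 fun y _ _ => hq y
    rw [Real.norm_eq_abs, abs_mul, abs_pow, sq, abs_of_pos one_half_pos]
    calc 1 / 2 * (|k⁻¹ * (p t (x + k) - p t x)| * |k⁻¹ * (p t (x + k) - p t x)|)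
        ≤ 1 * (L * (3 * L * (1 + x ^ 2)⁻¹)) := by
          refine mul_le_mul (by norm_num) ?_ (by positivity) zero_le_one
          exact mul_le_mul h₁ (hw k hk.1 hk.2 x) (abs_nonneg _) L0
      _ = _ := one_mul _

lemma second_sub (h : DecayingMKdV u p q r z)
    (hK : ∀ τ ∈ I, ∫ x, sobolevDensity u p q τ x ≤ K) {s t : ℝ} (hI : Set.uIcc s t ⊆ I) :
    (∫ x, 1 / 2 * q t x ^ 2) - ∫ x, 1 / 2 * q s x ^ 2
      = ∫ τ in s..t, -∫ x, 15 * (u τ x * p τ x * (q τ x * q τ x)) := by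
  obtain ⟨c, hc⟩ := h.exists_abs_integral_quotientSource_le hK
  have lim : Tendsto (fun k => ∫ τ in s..t, ∫ x, quotientSource u p q k τ x) (𝓝[>] 0)
      (𝓝 (∫ τ in s..t, -∫ x, 15 * (u τ x * p τ x * (q τ x * q τ x)))) := by
    refine intervalIntegral.tendsto_integral_filter_of_dominated_convergence (fun _ => c)
      (Eventually.of_forall fun k => ?_) ?_ (by simp)
      (ae_of_all _ fun τ _ => h.tendsto_integral_quotientSource τ)
    · exact ((h.continuous_quotientSource k).stronglyMeasurable.integral_prod_right
        (ν := volume)).aestronglyMeasurable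
    · filter_upwards [self_mem_nhdsWithin] with k hk
      exact ae_of_all _ fun τ hτ => hc τ (hI (Set.uIoc_subset_uIcc hτ)) k hk
  refine tendsto_nhds_unique ?_ lim
  refine ((h.tendsto_integral_quotient_sq t).sub (h.tendsto_integral_quotient_sq s)).congr' ?_
  filter_upwards [self_mem_nhdsWithin] with k hk
  exact h.p_quotient_sub hK hI (ne_of_gt hk)

end DecayingMKdV

lemma continuousAt_of_lowerSemicontinuousAt_add_sub {A G : ℝ → ℝ} {t : ℝ} (hA : ContinuousAt A t)
    (h₁ : LowerSemicontinuousAt (fun τ => A τ + G τ) t)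
    (h₂ : LowerSemicontinuousAt (fun τ => A τ - G τ) t) : ContinuousAt G t := by
  refine tendsto_order.2 ⟨fun a ha => ?_, fun a ha => ?_⟩
  · filter_upwards [h₁ (A t + (a + G t) / 2) (by dsimp only; linarith),
      hA.eventually_lt_const (show A t < A t + (G t - a) / 2 by linarith)] with τ h h'
    linarith
  · filter_upwards [h₂ (A t - (a + G t) / 2) (by dsimp only; linarith),
      hA.eventually_lt_const (show A t < A t + (a - G t) / 2 by linarith)] with τ h h'
    linarith

namespace DecayingMKdV

variable {u p q r z : ℝ → ℝ → ℝ} {I : Set ℝ} {K : ℝ}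

lemma second_energy_eq (h : DecayingMKdV u p q r z)
    (hK : ∀ τ ∈ I, ∫ x, sobolevDensity u p q τ x ≤ K) {s t : ℝ} (hI : Set.uIcc s t ⊆ I) :
    (∫ x, 1 / 2 * q t x ^ 2) + ∫ x, (-(5 / 2) * (u t x ^ 2 * p t x ^ 2) + 1 / 4 * u t x ^ 6)
      = (∫ x, 1 / 2 * q s x ^ 2)
        + ∫ x, (-(5 / 2) * (u s x ^ 2 * p s x ^ 2) + 1 / 4 * u s x ^ 6) := by
  have h₁ := h.second_sub hK hI
  have h₂ := h.correction_sub hK hI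
  rw [intervalIntegral.integral_neg] at h₁
  linarith

lemma density_parts_le (h : DecayingMKdV u p q r z) {t c : ℝ}
    (hc : ∫ x, sobolevDensity u p q t x ≤ c) :
    ∫ x, u t x ^ 2 ≤ c ∧ ∫ x, p t x ^ 2 ≤ c ∧ ∫ x, q t x ^ 2 ≤ c := by
  rw [h.integral_density] at hc
  have h₁ : 0 ≤ ∫ y, u t y ^ 2 := integral_nonneg fun y => sq_nonneg _
  have h₂ : 0 ≤ ∫ y, p t y ^ 2 := integral_nonneg fun y => sq_nonneg _
  have h₃ : 0 ≤ ∫ y, q t y ^ 2 := integral_nonneg fun y => sq_nonneg _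
  refine ⟨?_, ?_, ?_⟩ <;> linarith

/-- The conservation laws bound the `H²` norm in terms of its initial value. -/
lemma apriori_bound (h : DecayingMKdV u p q r z) (c : ℝ) :
    ∃ c', ∀ s t, BddAbove ((fun τ => ∫ x, sobolevDensity u p q τ x) '' Set.uIcc s t) →
      ∫ x, sobolevDensity u p q s x ≤ c → ∫ x, sobolevDensity u p q t x ≤ c' := by
  set P := 2 * c + (c + 1) * c ^ 2 with hP
  refine ⟨c + P + (c + c ^ 3 / 2 + 5 * ((P + c) * P)), fun s t ⟨K, hK⟩ hs => ?_⟩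
  have hK : ∀ τ ∈ Set.uIcc s t, ∫ x, sobolevDensity u p q τ x ≤ K := fun τ hτ =>
    hK (Set.mem_image_of_mem _ hτ)
  have mass := h.integral_u_sq_eq hK le_rfl
  have energy := h.energy_eq hK le_rfl
  have second := h.second_energy_eq hK le_rfl
  obtain ⟨us, ps, qs⟩ := h.density_parts_le hs
  have c0 : 0 ≤ c := (integral_nonneg fun x => sq_nonneg _).trans us
  have ut : ∫ x, u t x ^ 2 ≤ c := mass.trans_le us
  have ut0 : 0 ≤ ∫ x, u t x ^ 2 := integral_nonneg fun x => sq_nonneg _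
  have pt0 : 0 ≤ ∫ x, p t x ^ 2 := integral_nonneg fun x => sq_nonneg _
  have upper : ∫ x, (1 / 2 * p s x ^ 2 - 1 / 4 * u s x ^ 4) ≤ 1 / 2 * c := by
    have : ∫ x, (1 / 2 * p s x ^ 2 - 1 / 4 * u s x ^ 4) ≤ ∫ x, 1 / 2 * p s x ^ 2 :=
      integral_mono (h.integrable_energyDensity s) ((h.integrable_p s).const_mul _) fun x => by
        have : 0 ≤ u s x ^ 4 := by positivity
        dsimp only
        linarith
    rw [integral_const_mul] at this
    linarith
  have pt : ∫ x, p t x ^ 2 ≤ P := by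
    set m := ∫ x, u t x ^ 2 with hm
    set M := (c + 1)⁻¹ * (∫ y, p t y ^ 2) + (c + 1) * m with hM
    have hu : ∀ x, u t x ^ 2 ≤ M := fun x => by
      simpa using h.u_sq_le t x (ε := (c + 1)⁻¹) (by positivity)
    have lower : ∫ x, (1 / 2 * p t x ^ 2 - 1 / 4 * (M * u t x ^ 2))
        ≤ ∫ x, (1 / 2 * p t x ^ 2 - 1 / 4 * u t x ^ 4) :=
      integral_mono (((h.integrable_p t).const_mul _).sub
        (((h.integrable_u t).const_mul _).const_mul _)) (h.integrable_energyDensity t) fun x => by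
        dsimp only
        nlinarith [mul_le_mul_of_nonneg_right (hu x) (sq_nonneg (u t x))]
    rw [integral_sub ((h.integrable_p t).const_mul _)
      (((h.integrable_u t).const_mul _).const_mul _), integral_const_mul, integral_const_mul,
      integral_const_mul, ← hm] at lower
    have hMm : M * m ≤ (∫ x, p t x ^ 2) + (c + 1) * c ^ 2 := by
      have h₁ : (c + 1)⁻¹ * m ≤ 1 := by
        rw [inv_mul_le_iff₀ (by positivity)]
        linarith
      have h₂ : m ^ 2 ≤ c ^ 2 := pow_le_pow_left₀ ut0 ut 2
      calc M * m = ((c + 1)⁻¹ * m) * (∫ x, p t x ^ 2) + (c + 1) * m ^ 2 := by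
            rw [hM]
            ring
        _ ≤ 1 * (∫ x, p t x ^ 2) + (c + 1) * c ^ 2 := by gcongr
        _ = _ := by rw [one_mul]
    linarith
  have P0 : 0 ≤ P := pt0.trans pt
  have hu : ∀ x, u t x ^ 2 ≤ P + c := fun x => by
    have := h.u_sq_le t x one_pos
    rw [inv_one, one_mul, one_mul] at this
    linarith
  have hus : ∀ x, u s x ^ 2 ≤ c := fun x => (h.u_sq_le_density s x).trans hs
  have lower : ∫ x, -(5 / 2) * ((P + c) * p t x ^ 2)
      ≤ ∫ x, (-(5 / 2) * (u t x ^ 2 * p t x ^ 2) + 1 / 4 * u t x ^ 6) :=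
    integral_mono (((h.integrable_p t).const_mul _).const_mul _)
      (h.integrable_correctionDensity t) fun x => by
      dsimp only
      have : 0 ≤ u t x ^ 6 := by positivity
      linarith [mul_le_mul_of_nonneg_right (hu x) (sq_nonneg (p t x))]
  have upper₂ : ∫ x, (-(5 / 2) * (u s x ^ 2 * p s x ^ 2) + 1 / 4 * u s x ^ 6)
      ≤ ∫ x, 1 / 4 * (c ^ 2 * u s x ^ 2) :=
    integral_mono (h.integrable_correctionDensity s)
      (((h.integrable_u s).const_mul _).const_mul _) fun x => by
      dsimp only
      have h₁ : 0 ≤ u s x ^ 2 * p s x ^ 2 := by positivity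
      have h₂ := mul_le_mul_of_nonneg_right (pow_le_pow_left₀ (sq_nonneg _) (hus x) 2)
        (sq_nonneg (u s x))
      have h₃ : (u s x ^ 2) ^ 2 * u s x ^ 2 = u s x ^ 6 := by ring
      linarith
  simp only [integral_const_mul] at lower upper₂ second
  have h₁ : (P + c) * ∫ x, p t x ^ 2 ≤ (P + c) * P := by gcongr
  have h₂ : c ^ 2 * ∫ x, u s x ^ 2 ≤ c ^ 2 * c := by gcongr
  rw [h.integral_density]
  linarith

/-- The `H²` norm is locally bounded in time. -/
lemma locally_bounded (h : DecayingMKdV u p q r z) (t : ℝ) :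
    ∃ c, ∀ᶠ τ in 𝓝 t, ∫ x, sobolevDensity u p q τ x ≤ c := by
  refine LowerSemicontinuous.locally_bddAbove (fun τ => ?_) h.apriori_bound t
  exact lowerSemicontinuousAt_integral_of_nonneg h.continuous_density
    (Eventually.of_forall fun τ x => sobolevDensity_nonneg u p q τ x) h.integrable_density

lemma exists_lipschitz (h : DecayingMKdV u p q r z)
    (hK : ∀ τ ∈ I, ∫ x, sobolevDensity u p q τ x ≤ K) :
    ∃ c, ∀ s t, Set.uIcc s t ⊆ I →
      |(∫ x, sobolevDensity u p q t x) - ∫ x, sobolevDensity u p q s x| ≤ c * |t - s| := by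
  obtain ⟨c₁, h₁⟩ := h.gradient_sub hK
  obtain ⟨c₂, h₂⟩ := (h.dominated_correctionSource hK).exists_abs_integral_le
    h.integrable_density hK
  refine ⟨c₁ + 2 * c₂, fun s t hI => ?_⟩
  have h₃ := h.second_sub hK hI
  have hle : ‖∫ τ in s..t, -∫ x, 15 * (u τ x * p τ x * (q τ x * q τ x))‖ ≤ c₂ * |t - s| :=
    intervalIntegral.norm_integral_le_of_norm_le_const fun τ hτ => by
      rw [norm_neg]
      exact h₂ τ (hI (Set.uIoc_subset_uIcc hτ))
  rw [← h₃, integral_const_mul, integral_const_mul, Real.norm_eq_abs, abs_le] at hle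
  have h₄ := abs_le.1 (h₁ s t hI)
  rw [h.integral_density, h.integral_density, h.integral_u_sq_eq hK hI, abs_le]
  constructor <;> linarith [hle.1, hle.2, h₄.1, h₄.2]

lemma exists_ball (h : DecayingMKdV u p q r z) (t : ℝ) :
    ∃ K, ∃ I ∈ 𝓝 t, (∀ τ ∈ I, Set.uIcc t τ ⊆ I) ∧
      ∀ τ ∈ I, ∫ x, sobolevDensity u p q τ x ≤ K := by
  obtain ⟨K, hK⟩ := h.locally_bounded t
  obtain ⟨ε, hε, hball⟩ := Metric.eventually_nhds_iff_ball.1 hK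
  refine ⟨K, Metric.ball t ε, Metric.ball_mem_nhds t hε, fun τ hτ => ?_, hball⟩
  exact (convex_ball t ε).ordConnected.uIcc_subset (Metric.mem_ball_self hε) hτ

lemma continuousAt_integral_density (h : DecayingMKdV u p q r z) (t : ℝ) :
    ContinuousAt (fun τ => ∫ x, sobolevDensity u p q τ x) t := by
  obtain ⟨K, I, hI, hsub, hK⟩ := h.exists_ball t
  obtain ⟨c, hc⟩ := h.exists_lipschitz hK
  refine tendsto_iff_norm_sub_tendsto_zero.2 (squeeze_zero' (Eventually.of_forall fun τ =>
    norm_nonneg _) (g := fun τ => c * |τ - t|) ?_ ?_)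
  · filter_upwards [hI] with τ hτ using hc t τ (hsub τ hτ)
  · have : Continuous fun τ => c * |τ - t| := by fun_prop
    simpa using this.tendsto t

/-- The weighted energy flux is continuous in time, and is the time derivative of the weighted
energy. -/
lemma hasDerivAt_energy (h : DecayingMKdV u p q r z) {φ₀ φ₁ φ₂ φ₃ : ℝ → ℝ} {M : ℝ}
    (w : BoundedWeight φ₀ φ₁ φ₂ φ₃ M) (t : ℝ) :
    HasDerivAt (fun τ => ∫ x, (1 / 2 * p τ x ^ 2 - 1 / 4 * u τ x ^ 4) * φ₀ x)
      ((∫ x, 1 / 2 * p t x ^ 2 * φ₃ x) - ∫ x,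
        (q t x ^ 2 - 3 * u t x ^ 2 * p t x ^ 2 + 1 / 2 * (q t x + u t x ^ 3) ^ 2) * φ₁ x) t := by
  obtain ⟨K, I, hI, hsub, hK⟩ := h.exists_ball t
  have cu := h.cu
  have cp := h.cp
  have cq := h.cq
  have c₁ := w.c₁
  have c₃ := w.c₃
  have M0 : 0 ≤ M := (abs_nonneg _).trans (w.le₀ 0)
  have tt : t ∈ (Set.univ : Set ℝ) := Set.mem_univ t
  have bounded₁ : ∀ J : Set ℝ, DominatedOn J (fun _ x => φ₁ x) fun _ _ => 1 := fun J =>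
    ⟨M, M0, fun τ _ x => by simpa using w.le₁ x⟩
  have bounded₃ : ∀ J : Set ℝ, DominatedOn J (fun _ x => φ₃ x) fun _ _ => 1 := fun J =>
    ⟨M, M0, fun τ _ x => by simpa using w.le₃ x⟩
  have dom₁ : ∀ {J : Set ℝ} {c : ℝ}, (∀ τ ∈ J, ∫ x, sobolevDensity u p q τ x ≤ c) →
      DominatedOn J (fun τ x => (q τ x ^ 2 - 3 * u τ x ^ 2 * p τ x ^ 2
        + 1 / 2 * (q τ x + u τ x ^ 3) ^ 2) * φ₁ x) (sobolevDensity u p q) := fun hJ =>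
    ((h.dominated_energyFlux hJ).mul_bounded (bounded₁ _)).congr fun τ x => mul_comm _ _
  have dom₃ : ∀ J : Set ℝ, DominatedOn J (fun τ x => 1 / 2 * p τ x ^ 2 * φ₃ x)
      (sobolevDensity u p q) := fun J =>
    (h.dominated_half_p_sq.mul_bounded ((bounded₃ _).const_mul (-1))).congr fun τ x => by ring
  have int₃ : ∀ τ, Integrable fun x => 1 / 2 * p τ x ^ 2 * φ₃ x := fun τ =>
    (dom₃ Set.univ).integrable (by fun_prop) (Set.mem_univ τ) (h.integrable_density τ)
  have int₁ : ∀ τ, Integrable fun x => (q τ x ^ 2 - 3 * u τ x ^ 2 * p τ x ^ 2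
        + 1 / 2 * (q τ x + u τ x ^ 3) ^ 2) * φ₁ x := fun τ =>
    (dom₁ (J := {τ}) (c := ∫ x, sobolevDensity u p q τ x)
      (by rintro _ rfl; exact le_rfl)).integrable (by fun_prop) rfl (h.integrable_density τ)
  set g : ℝ → ℝ → ℝ := fun τ x => 1 / 2 * p τ x ^ 2 * φ₃ x
    - (q τ x ^ 2 - 3 * u τ x ^ 2 * p τ x ^ 2 + 1 / 2 * (q τ x + u τ x ^ 3) ^ 2) * φ₁ x with hg
  have cg : Continuous (Function.uncurry g) := by fun_prop
  have ig : ∀ τ, Integrable (g τ) := fun τ => (int₃ τ).sub (int₁ τ)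
  obtain ⟨c, -, hc⟩ : DominatedOn I g (sobolevDensity u p q) := (dom₃ I).sub (dom₁ hK)
  have cd := h.continuous_density
  have id := fun τ => (h.integrable_density τ).const_mul c
  have cG : ContinuousAt (fun τ => ∫ x, g τ x) t := by
    refine continuousAt_of_lowerSemicontinuousAt_add_sub
      ((h.continuousAt_integral_density t).const_mul c) ?_ ?_
    · simp_rw [← integral_const_mul, ← integral_add (id _) (ig _)]
      refine lowerSemicontinuousAt_integral_of_nonneg (by fun_prop) ?_ fun τ => (id τ).add (ig τ)
      filter_upwards [hI] with τ hτ x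
      linarith [(abs_le.1 (hc τ hτ x)).1]
    · simp_rw [← integral_const_mul, ← integral_sub (id _) (ig _)]
      refine lowerSemicontinuousAt_integral_of_nonneg (by fun_prop) ?_ fun τ => (id τ).sub (ig τ)
      filter_upwards [hI] with τ hτ x
      linarith [(abs_le.1 (hc τ hτ x)).2]
  have hderiv := intervalIntegral.integral_hasDerivAt_right (a := t)
    IntervalIntegrable.refl
    (cg.stronglyMeasurable.integral_prod_right (ν := volume)).stronglyMeasurableAtFilter cG
  rw [← integral_sub (int₃ t) (int₁ t)]
  refine (hderiv.add_const
    (∫ x, (1 / 2 * p t x ^ 2 - 1 / 4 * u t x ^ 4) * φ₀ x)).congr_of_eventuallyEq ?_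
  filter_upwards [hI] with τ hτ
  linarith [h.energy_sub hK (hsub τ hτ) w]

end DecayingMKdV

lemma hasDerivAt_deriv_of_contDiff_uncurry {D : ℝ → ℝ → ℝ}
    (h : ContDiff ℝ (⊤ : ℕ∞) (Function.uncurry D)) (t x : ℝ) :
    HasDerivAt (D t) (deriv (D t) x) x := by
  have : ContDiff ℝ (⊤ : ℕ∞) (D t) := h.comp (contDiff_const.prodMk contDiff_id)
  exact (this.differentiable (by simp) x).hasDerivAt

lemma hasDerivAt_uncurry_right {D : ℝ → ℝ → ℝ}
    (h : ContDiff ℝ (⊤ : ℕ∞) (Function.uncurry D)) (t x : ℝ) :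
    HasDerivAt (D t) (fderiv ℝ (Function.uncurry D) (t, x) (0, 1)) x :=
  HasFDerivAt.comp_hasDerivAt (f := fun y => (t, y)) x
    (h.differentiable (by simp) (t, x)).hasFDerivAt
    ((hasDerivAt_const x t).prodMk (hasDerivAt_id x))

lemma hasDerivAt_uncurry_left {D : ℝ → ℝ → ℝ}
    (h : ContDiff ℝ (⊤ : ℕ∞) (Function.uncurry D)) (t x : ℝ) :
    HasDerivAt (fun s => D s x) (fderiv ℝ (Function.uncurry D) (t, x) (1, 0)) t :=
  HasFDerivAt.comp_hasDerivAt (f := fun s => (s, x)) t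
    (h.differentiable (by simp) (t, x)).hasFDerivAt
    ((hasDerivAt_id t).prodMk (hasDerivAt_const t x))

lemma ContDiff.uncurry_deriv_right {D : ℝ → ℝ → ℝ}
    (h : ContDiff ℝ (⊤ : ℕ∞) (Function.uncurry D)) :
    ContDiff ℝ (⊤ : ℕ∞) (Function.uncurry fun t => deriv (D t)) := by
  have e : (Function.uncurry fun t => deriv (D t))
      = fun v => fderiv ℝ (Function.uncurry D) v (0, 1) := by
    ext ⟨t, x⟩
    exact (hasDerivAt_uncurry_right h t x).deriv
  rw [e]
  exact (h.fderiv_right (by simp)).clm_apply contDiff_const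

/-- Mixed partial derivatives of a smooth function commute. -/
lemma hasDerivAt_left_deriv_right {D : ℝ → ℝ → ℝ}
    (h : ContDiff ℝ (⊤ : ℕ∞) (Function.uncurry D)) (t x : ℝ) :
    HasDerivAt (fun s => deriv (D s) x) (deriv (fun y => deriv (fun s => D s y) t) x) t := by
  have hd : DifferentiableAt ℝ (fderiv ℝ (Function.uncurry D)) (t, x) :=
    (h.fderiv_right (m := (⊤ : ℕ∞)) (by simp)).differentiable (by simp) _
  have hsymm : IsSymmSndFDerivAt ℝ (Function.uncurry D) (t, x) :=
    h.contDiffAt.isSymmSndFDerivAt (by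
      simp only [minSmoothness_of_isRCLikeNormedField]
      exact WithTop.coe_le_coe.2 (le_top : (2 : ℕ∞) ≤ ⊤))
  have e₁ : (fun s => deriv (D s) x) = fun s => fderiv ℝ (Function.uncurry D) (s, x) (0, 1) :=
    funext fun s => (hasDerivAt_uncurry_right h s x).deriv
  have e₂ : (fun y => deriv (fun s => D s y) t)
      = fun y => fderiv ℝ (Function.uncurry D) (t, y) (1, 0) :=
    funext fun y => (hasDerivAt_uncurry_left h t y).deriv
  have h₁ := (HasFDerivAt.comp_hasDerivAt (f := fun s => (s, x)) t hd.hasFDerivAt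
    ((hasDerivAt_id t).prodMk (hasDerivAt_const t x))).clm_apply
      (hasDerivAt_const t ((0 : ℝ), (1 : ℝ)))
  have h₂ := (HasFDerivAt.comp_hasDerivAt (f := fun y => (t, y)) x hd.hasFDerivAt
    ((hasDerivAt_const x t).prodMk (hasDerivAt_id x))).clm_apply
      (hasDerivAt_const x ((1 : ℝ), (0 : ℝ)))
  rw [e₁, e₂]
  simp only [map_zero, add_zero] at h₁ h₂
  have h₃ := h₂.deriv
  simp only [Function.comp_def] at h₁ h₃
  rw [h₃, hsymm (0, 1) (1, 0)]
  exact h₁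

lemma exists_mul_one_add_sq_le {g : ℝ → ℝ}
    (h : ∀ n : ℕ, ∃ C : ℝ, ∀ x : ℝ, |x| ^ n * |g x| ≤ C) :
    ∃ c, ∀ x, |g x| * (1 + x ^ 2) ≤ c := by
  obtain ⟨a, ha⟩ := h 0
  obtain ⟨b, hb⟩ := h 2
  refine ⟨a + b, fun x => ?_⟩
  have h₀ := ha x
  have h₂ := hb x
  rw [sq_abs] at h₂
  linarith

lemma iteratedDeriv_two_eq (g : ℝ → ℝ) : iteratedDeriv 2 g = deriv (deriv g) := by
  rw [iteratedDeriv_succ, iteratedDeriv_one]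

lemma exists_boundedWeight {f : ℝ → ℝ} (hf : ContDiff ℝ 3 f)
    (hb : ∀ k : ℕ, k ≤ 3 → ∃ C : ℝ, ∀ x : ℝ, |iteratedDeriv k f x| ≤ C) :
    ∃ M, BoundedWeight f (deriv f) (iteratedDeriv 2 f) (iteratedDeriv 3 f) M := by
  have hd : ∀ k : ℕ, k < 3 → ∀ x,
      HasDerivAt (iteratedDeriv k f) (iteratedDeriv (k + 1) f x) x := fun k hk x => by
    rw [iteratedDeriv_succ]
    exact (hf.differentiable_iteratedDeriv k (by exact_mod_cast hk) x).hasDerivAt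
  have hc : ∀ k : ℕ, k ≤ 3 → Continuous (iteratedDeriv k f) := fun k hk =>
    hf.continuous_iteratedDeriv k (by exact_mod_cast hk)
  obtain ⟨C₀, h₀⟩ := hb 0 (by norm_num)
  obtain ⟨C₁, h₁⟩ := hb 1 (by norm_num)
  obtain ⟨C₂, h₂⟩ := hb 2 (by norm_num)
  obtain ⟨C₃, h₃⟩ := hb 3 le_rfl
  have d₀ := hd 0 (by norm_num)
  have d₁ := hd 1 (by norm_num)
  have c₀ := hc 0 (by norm_num)
  have c₁ := hc 1 (by norm_num)
  simp only [zero_add, iteratedDeriv_zero, iteratedDeriv_one] at d₀ d₁ c₀ c₁ h₀ h₁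
  refine ⟨max (max C₀ C₁) (max C₂ C₃), d₀, d₁, hd 2 (by norm_num), c₀, c₁,
    hc 2 (by norm_num), hc 3 le_rfl, fun x => (h₀ x).trans ?_, fun x => (h₁ x).trans ?_,
    fun x => (h₂ x).trans ?_, fun x => (h₃ x).trans ?_⟩ <;> simp

lemma decayingMKdV_of_contDiff {u : ℝ → ℝ → ℝ}
    (hu : ContDiff ℝ (⊤ : ℕ∞) (Function.uncurry u))
    (hmkdv : ∀ t x : ℝ, deriv (fun s => u s x) t
      + deriv (fun y => deriv (deriv (u t)) y + (u t y) ^ 3) x = 0)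
    (hdecay : ∀ t : ℝ, ∀ k : ℕ, k ≤ 3 → ∀ n : ℕ,
      ∃ C : ℝ, ∀ x : ℝ, |x| ^ n * |iteratedDeriv k (u t) x| ≤ C) :
    DecayingMKdV u (fun t => deriv (u t)) (fun t => deriv (deriv (u t)))
      (fun t => deriv (deriv (deriv (u t)))) (fun t => deriv (deriv (deriv (deriv (u t))))) := by
  have hp := hu.uncurry_deriv_right
  have hq := hp.uncurry_deriv_right
  have hr := hq.uncurry_deriv_right
  have hz := hr.uncurry_deriv_right
  have xu := hasDerivAt_deriv_of_contDiff_uncurry hu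
  have xp := hasDerivAt_deriv_of_contDiff_uncurry hp
  have xq := hasDerivAt_deriv_of_contDiff_uncurry hq
  have xr := hasDerivAt_deriv_of_contDiff_uncurry hr
  have ut : ∀ t x, deriv (fun s => u s x) t
      = -(deriv (deriv (deriv (u t))) x + 3 * u t x ^ 2 * deriv (u t) x) := fun t x => by
    have e := ((xq t x).fun_add ((xu t x).fun_pow 3)).deriv
    have := hmkdv t x
    rw [e] at this
    norm_num at this
    linarith
  refine ⟨hu.continuous, hp.continuous, hq.continuous, hr.continuous, hz.continuous, xu, xp, xq,
    xr, fun t x => ?_, fun t x => ?_, fun t => ?_, fun t => ?_, fun t => ?_⟩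
  · rw [← ut]
    exact (hasDerivAt_uncurry_left hu t x).differentiableAt.hasDerivAt
  · have h := hasDerivAt_left_deriv_right hu t x
    simp_rw [ut] at h
    have e := ((xr t x).fun_add ((((xu t x).fun_pow 2).const_mul 3).fun_mul (xp t x))).fun_neg
    rw [e.deriv] at h
    convert h using 1
    norm_num
    ring
  · simpa using exists_mul_one_add_sq_le fun n => hdecay t 0 (by norm_num) n
  · simpa [iteratedDeriv_one] using exists_mul_one_add_sq_le fun n => hdecay t 1 (by norm_num) n
  · simpa [iteratedDeriv_two_eq] using
      exists_mul_one_add_sq_le fun n => hdecay t 2 (by norm_num) n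

end LocalizedEnergy

/-- Time derivative of the localized energy: if `f` is `C³` and bounded together with its
first three derivatives, and `u` is a smooth classical solution of mKdV
(`u_t + (u_xx + u³)_x = 0`) which is Schwartz in `x` (together with its `x`-derivatives up to
order three) at each time, then
`(d/dt) ∫ [(1/2) u_x² - (1/4) u⁴] f
  = ∫ [-(1/2)(u_xx + u³)² - u_xx² + 3 u² u_x²] f' + (1/2) ∫ u_x² f'''`. -/
theorem localized_energy_time_derivative
    (f : ℝ → ℝ) (hf : ContDiff ℝ 3 f)
    (hfbdd : ∀ k : ℕ, k ≤ 3 → ∃ C : ℝ, ∀ x : ℝ, |iteratedDeriv k f x| ≤ C)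
    (u : ℝ → ℝ → ℝ) (hu : ContDiff ℝ (⊤ : ℕ∞) (Function.uncurry u))
    (hmkdv : ∀ t x : ℝ,
      deriv (fun s => u s x) t
        + deriv (fun y => deriv (deriv (u t)) y + (u t y) ^ 3) x = 0)
    (hdecay : ∀ t : ℝ, ∀ k : ℕ, k ≤ 3 → ∀ n : ℕ,
      ∃ C : ℝ, ∀ x : ℝ, |x| ^ n * |iteratedDeriv k (u t) x| ≤ C) :
    ∀ t : ℝ,
      HasDerivAt
        (fun s => ∫ x : ℝ, ((1 / 2) * (deriv (u s) x) ^ 2 - (1 / 4) * (u s x) ^ 4) * f x)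
        ((∫ x : ℝ,
            (-(1 / 2) * (deriv (deriv (u t)) x + (u t x) ^ 3) ^ 2
              - (deriv (deriv (u t)) x) ^ 2
              + 3 * (u t x) ^ 2 * (deriv (u t) x) ^ 2) * deriv f x)
          + (1 / 2) * ∫ x : ℝ, (deriv (u t) x) ^ 2 * iteratedDeriv 3 f x) t := by
  intro t
  obtain ⟨M, w⟩ := exists_boundedWeight hf hfbdd
  convert (decayingMKdV_of_contDiff hu hmkdv hdecay).hasDerivAt_energy w t using 1
  rw [add_comm, sub_eq_add_neg, ← integral_const_mul, ← integral_neg]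
  congr 1 <;> exact integral_congr_ae (.of_forall fun x => by ring)
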